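/- arXiv:1611.08039 — 2 statements merged into one kernel-verified Lean document; each statement's English description precedes it below -/
import Mathlib

section
/- The circuit 4-step conjecture holds: Δ_C(8,4) = 4, i.e., every 4-dimensional polyhedron (bounded or unbounded) with 8 facets has circuit diameter at most 4, and this bound is attained. -/
open scoped BigOperators

/-- Data defining a polyhedron `{z ∈ ℝ^d : A z ≥ b}` with rational data.
Under the `IsProper` assumption below it is full-dimensional with an
irredundant description, hence `d`-dimensional with exactly `f` facets. -/
structure PolyData (d f : ℕ) where
  A : Matrix (Fin f) (Fin d) ℚ
  b : Fin f → ℚ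

namespace PolyData

variable {d f : ℕ}

/-- The `i`-th row of `A` (outer normal of the `i`-th facet), as a real vector. -/
def row (P : PolyData d f) (i : Fin f) : Fin d → ℝ := fun j => (P.A i j : ℝ)

/-- The `i`-th right-hand side, as a real number. -/
def rhs (P : PolyData d f) (i : Fin f) : ℝ := (P.b i : ℝ)

/-- Value of the `i`-th linear form at `z`. -/
def eval (P : PolyData d f) (i : Fin f) (z : Fin d → ℝ) : ℝ := ∑ j, P.row i j * z j

/-- The feasible set `{z : A z ≥ b}`. -/
def toSet (P : PolyData d f) : Set (Fin d → ℝ) := {z | ∀ i, P.rhs i ≤ P.eval i z}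

/-- Indices of the constraints (facets) active (incident) at `z`. -/
def activeAt (P : PolyData d f) (z : Fin d → ℝ) : Set (Fin f) := {i | P.eval i z = P.rhs i}

/-- The `i`-th facet, as a subset of the polyhedron. -/
def facet (P : PolyData d f) (i : Fin f) : Set (Fin d → ℝ) :=
  {z ∈ P.toSet | P.eval i z = P.rhs i}

/-- The standing assumption: the polyhedron is full-dimensional and the
description is irredundant, i.e. every inequality is facet-defining. -/
def IsProper (P : PolyData d f) : Prop :=
  (∃ z, ∀ i, P.rhs i < P.eval i z) ∧
  ∀ i, ∃ z ∈ P.toSet, P.eval i z = P.rhs i ∧ ∀ i', i' ≠ i → P.rhs i' < P.eval i' z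

/-- A vertex: a feasible point whose active outer normals span `ℝ^d`. -/
def IsVertex (P : PolyData d f) (v : Fin d → ℝ) : Prop :=
  v ∈ P.toSet ∧ Submodule.span ℝ (P.row '' P.activeAt v) = ⊤

/-- A circuit direction of `P`: a nonzero `g` such that `A g` is
support-minimal in `{A x : x ≠ 0}` (taken here up to scaling). -/
def IsCircuit (P : PolyData d f) (g : Fin d → ℝ) : Prop :=
  g ≠ 0 ∧ ∀ x : Fin d → ℝ, x ≠ 0 →
    {i | P.eval i x ≠ 0} ⊆ {i | P.eval i g ≠ 0} →
    {i | P.eval i x ≠ 0} = {i | P.eval i g ≠ 0}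

/-- The set of circuits of `P`. -/
def circuits (P : PolyData d f) : Set (Fin d → ℝ) := {g | P.IsCircuit g}

/-- A (maximal) circuit walk `y 0, …, y k` of length `k`. -/
def IsCircuitWalk (P : PolyData d f) {k : ℕ} (y : Fin (k+1) → Fin d → ℝ) : Prop :=
  (∀ i, y i ∈ P.toSet) ∧
  ∀ i : Fin k, ∃ g ∈ P.circuits, ∃ α : ℝ, 0 < α ∧
    y i.succ = y i.castSucc + α • g ∧
    ∀ β : ℝ, α < β → y i.castSucc + β • g ∉ P.toSet

/-- The circuit distance from `u` to `v`: minimum length of a circuit walk. -/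
noncomputable def circuitDistance (P : PolyData d f) (u v : Fin d → ℝ) : ℕ∞ :=
  sInf {n : ℕ∞ | ∃ k : ℕ, n = (k : ℕ∞) ∧ ∃ y : Fin (k+1) → Fin d → ℝ,
    P.IsCircuitWalk y ∧ y 0 = u ∧ y (Fin.last k) = v}

/-- The circuit diameter: maximum circuit distance between two vertices. -/
noncomputable def circuitDiameter (P : PolyData d f) : ℕ∞ :=
  ⨆ (u : Fin d → ℝ) (v : Fin d → ℝ) (_ : P.IsVertex u) (_ : P.IsVertex v),
    P.circuitDistance u v

/-- `u` and `v` are joined by an edge of `P`. -/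
def IsEdge (P : PolyData d f) (u v : Fin d → ℝ) : Prop :=
  P.IsVertex u ∧ P.IsVertex v ∧ u ≠ v ∧
  segment ℝ u v = {z ∈ P.toSet | P.activeAt u ∩ P.activeAt v ⊆ P.activeAt z}

/-- An edge walk along vertices of `P`. -/
def IsEdgeWalk (P : PolyData d f) {k : ℕ} (y : Fin (k+1) → Fin d → ℝ) : Prop :=
  ∀ i : Fin k, P.IsEdge (y i.castSucc) (y i.succ)

/-- Combinatorial (edge) distance between two vertices. -/
noncomputable def edgeDistance (P : PolyData d f) (u v : Fin d → ℝ) : ℕ∞ :=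
  sInf {n : ℕ∞ | ∃ k : ℕ, n = (k : ℕ∞) ∧ ∃ y : Fin (k+1) → Fin d → ℝ,
    P.IsEdgeWalk y ∧ y 0 = u ∧ y (Fin.last k) = v}

/-- Combinatorial (edge) diameter. -/
noncomputable def edgeDiameter (P : PolyData d f) : ℕ∞ :=
  ⨆ (u : Fin d → ℝ) (v : Fin d → ℝ) (_ : P.IsVertex u) (_ : P.IsVertex v),
    P.edgeDistance u v

end PolyData

/-- `Δ_E(f,d)`: maximum combinatorial diameter of a `d`-dimensional
polyhedron with `f` facets. -/
noncomputable def maxEdgeDiameter (f d : ℕ) : ℕ∞ :=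
  ⨆ (P : PolyData d f) (_ : P.IsProper), P.edgeDiameter

/-- `Δ_C(f,d)`: maximum circuit diameter of a `d`-dimensional polyhedron
with `f` facets. -/
noncomputable def maxCircuitDiameter (f d : ℕ) : ℕ∞ :=
  ⨆ (P : PolyData d f) (_ : P.IsProper), P.circuitDiameter

/-- `Δ_C^u(f,d)`: maximum circuit diameter of an unbounded `d`-dimensional
polyhedron with `f` facets. -/
noncomputable def maxUnboundedCircuitDiameter (f d : ℕ) : ℕ∞ :=
  ⨆ (P : PolyData d f) (_ : P.IsProper ∧ ¬ Bornology.IsBounded P.toSet),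
    P.circuitDiameter

namespace PolyData

variable {d f : ℕ}

/-- A walk is simple if each step enters exactly one new facet. -/
def IsSimpleWalk (P : PolyData d f) {k : ℕ} (y : Fin (k+1) → Fin d → ℝ) : Prop :=
  ∀ i : Fin k, (P.activeAt (y i.succ) \ P.activeAt (y i.castSucc)).ncard = 1

/-- `P` is `C`-simple: all circuit walks of length at most `Δ_E(f,d)` are simple. -/
def IsCSimple (P : PolyData d f) : Prop :=
  ∀ k : ℕ, (k : ℕ∞) ≤ maxEdgeDiameter f d →
    ∀ y : Fin (k+1) → Fin d → ℝ, P.IsCircuitWalk y → P.IsSimpleWalk y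

/-- A non-revisiting walk: each step enters a facet containing no earlier
point of the walk. -/
def IsNonRevisiting (P : PolyData d f) {k : ℕ} (y : Fin (k+1) → Fin d → ℝ) : Prop :=
  ∀ i : Fin k, ∃ j : Fin f, j ∈ P.activeAt (y i.succ) ∧
    ∀ i' : Fin (k+1), i' ≤ i.castSucc → j ∉ P.activeAt (y i')

/-- `P` is a simple polyhedron: every vertex lies on exactly `d` facets. -/
def IsSimplePoly (P : PolyData d f) : Prop :=
  ∀ v, P.IsVertex v → (P.activeAt v).ncard = d

end PolyData

/-- Append a last coordinate: `(z, t) ∈ ℝ^{d+1}`. -/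
def snocVec {d : ℕ} (z : Fin d → ℝ) (t : ℝ) : Fin (d+1) → ℝ := Fin.snoc z t

namespace PolyData

variable {d f : ℕ}

/-- `W` is a wedge on `P` over the facet with index `i₀`:
`W = H^≤ ∩ (P × [0,∞))`, where the boundary hyperplane `H = {w : a·w = β}`
of the halfspace `H^≤` contains `P × {0}` on its feasible side, meets the
interior of `P × [0,∞)`, and meets `P × {0}` exactly in the facet `i₀`. -/
def IsWedgeOver (W : PolyData (d+1) (f+1)) (P : PolyData d f) (i₀ : Fin f) : Prop :=
  ∃ (a : Fin (d+1) → ℝ) (β : ℝ),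
    (∀ z ∈ P.toSet, ∑ j, a j * snocVec z 0 j ≤ β) ∧
    (∃ z, (∀ i, P.rhs i < P.eval i z) ∧ ∃ t : ℝ, 0 < t ∧ ∑ j, a j * snocVec z t j = β) ∧
    (∀ z ∈ P.toSet, (∑ j, a j * snocVec z 0 j = β ↔ z ∈ P.facet i₀)) ∧
    W.toSet = {w | ∑ j, a j * w j ≤ β} ∩
      {w | ∃ z ∈ P.toSet, ∃ t : ℝ, 0 ≤ t ∧ w = snocVec z t}

/-- `P` is wedge-simple: it is `C`-simple and over every facet there is a
`C`-simple wedge. -/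
def IsWedgeSimple (P : PolyData d f) : Prop :=
  P.IsCSimple ∧ ∀ i₀ : Fin f, ∃ W : PolyData (d+1) (f+1),
    W.IsProper ∧ W.IsWedgeOver P i₀ ∧ W.IsCSimple

end PolyData

/-- `k`-wedge-simplicity: `0`-wedge-simple means `C`-simple, and `P` is
`(k+1)`-wedge-simple if it is `C`-simple and over every facet there is a
`k`-wedge-simple wedge.  In particular `1`-wedge-simple = wedge-simple. -/
def IsKWedgeSimpleAux : ℕ → (d f : ℕ) → PolyData d f → Prop
  | 0, _, _, P => P.IsCSimple
  | (k+1), d, f, P => P.IsCSimple ∧ ∀ i₀ : Fin f,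
      ∃ W : PolyData (d+1) (f+1), W.IsProper ∧ W.IsWedgeOver P i₀ ∧
        IsKWedgeSimpleAux k (d+1) (f+1) W

def IsKWedgeSimple (k : ℕ) {d f : ℕ} (P : PolyData d f) : Prop :=
  IsKWedgeSimpleAux k d f P

namespace PolyData

variable {d : ℕ}

/-- `(P, u, v)` is a Dantzig figure: a `d`-dimensional polyhedron with `2d`
facets, `d` of which are incident to the vertex `u` and the other `d` to the
vertex `v`. -/
def IsDantzigFigure (P : PolyData d (2*d)) (u v : Fin d → ℝ) : Prop :=
  P.IsVertex u ∧ P.IsVertex v ∧ Disjoint (P.activeAt u) (P.activeAt v) ∧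
  P.activeAt u ∪ P.activeAt v = Set.univ ∧
  (P.activeAt u).ncard = d ∧ (P.activeAt v).ncard = d

end PolyData

/-- The (exposed) faces of a polyhedron, each obtained by turning a subset of
the inequalities into equations. -/
def PolyData.faces {d f : ℕ} (P : PolyData d f) : Set (Set (Fin d → ℝ)) :=
  {F | ∃ S : Set (Fin f), F = {z ∈ P.toSet | S ⊆ P.activeAt z}}

/-- Combinatorial equivalence: an inclusion-preserving bijection between the
face lattices. -/
def CombEquiv {d f d' f' : ℕ} (P : PolyData d f) (Q : PolyData d' f') : Prop :=
  ∃ φ : Set (Fin d → ℝ) → Set (Fin d' → ℝ),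
    Set.BijOn φ P.faces Q.faces ∧
    ∀ F ∈ P.faces, ∀ G ∈ P.faces, (F ⊆ G ↔ φ F ⊆ φ G)

/-- Two facets are adjacent if they share a ridge (a codimension-2 face). -/
def PolyData.AdjacentFacets {d f : ℕ} (P : PolyData d f) (i j : Fin f) : Prop :=
  i ≠ j ∧ Module.finrank ℝ (affineSpan ℝ (P.facet i ∩ P.facet j)).direction = d - 2

/-- The Klee–Walkup polyhedron `U_4`. -/
def U4 : PolyData 4 8 where
  A := !![-6,-3,0,1; -3,-6,1,0; -35,-45,6,3; -45,-35,3,6;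
          1,0,0,0; 0,1,0,0; 0,0,1,0; 0,0,0,1]
  b := ![-1,-1,-8,-8,0,0,0,0]

namespace PolyData

variable {d f : ℕ}

theorem eval_add (P : PolyData d f) (i : Fin f) (z w : Fin d → ℝ) :
    P.eval i (z + w) = P.eval i z + P.eval i w := by
  simp [eval, mul_add, Finset.sum_add_distrib]

theorem eval_smul (P : PolyData d f) (i : Fin f) (c : ℝ) (z : Fin d → ℝ) :
    P.eval i (c • z) = c * P.eval i z := by
  simp only [eval, Pi.smul_apply, smul_eq_mul, Finset.mul_sum]
  exact Finset.sum_congr rfl fun j _ => by ring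

theorem eval_neg (P : PolyData d f) (i : Fin f) (z : Fin d → ℝ) :
    P.eval i (-z) = -P.eval i z := by
  simp [eval]

theorem eval_sub (P : PolyData d f) (i : Fin f) (z w : Fin d → ℝ) :
    P.eval i (z - w) = P.eval i z - P.eval i w := by
  simp [eval, mul_sub, Finset.sum_sub_distrib]

theorem eval_zero (P : PolyData d f) (i : Fin f) : P.eval i 0 = 0 := by
  simp [eval]

theorem eval_sum (P : PolyData d f) (i : Fin f) {ι : Type*} (s : Finset ι)
    (z : ι → Fin d → ℝ) : P.eval i (∑ k ∈ s, z k) = ∑ k ∈ s, P.eval i (z k) := by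
  classical
  induction s using Finset.induction_on with
  | empty => simp [eval_zero]
  | insert a s ha ih => rw [Finset.sum_insert ha, Finset.sum_insert ha, eval_add, ih]

/-- A direction spanning the common kernel of a set of rows is a circuit. -/
theorem isCircuit_of_kernel (P : PolyData d f) {g : Fin d → ℝ} (hg : g ≠ 0) (T : Set (Fin f))
    (hT : ∀ k ∈ T, P.eval k g = 0)
    (h : ∀ x, (∀ k ∈ T, P.eval k x = 0) → ∃ c : ℝ, x = c • g) : P.IsCircuit g := by
  refine ⟨hg, fun x hx hsub => ?_⟩
  obtain ⟨c, rfl⟩ := h x fun k hk => by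
    by_contra hne
    exact hsub (a := k) hne (hT k hk)
  have hc : c ≠ 0 := by
    rintro rfl
    simp at hx
  ext k
  simp [eval_smul, hc]

/-- A maximal circuit step that is allowed to have length zero. -/
def WeakStep (P : PolyData d f) (z z' : Fin d → ℝ) : Prop :=
  z' ∈ P.toSet ∧ ∃ g ∈ P.circuits, ∃ α : ℝ, 0 ≤ α ∧ z' = z + α • g ∧
    ∃ i, P.eval i g < 0 ∧ P.eval i z' = P.rhs i

/-- `v` can be reached from `z` by at most `n` maximal circuit steps. -/
def Reach (P : PolyData d f) : ℕ → (Fin d → ℝ) → (Fin d → ℝ) → Prop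
  | 0, z, v => z = v
  | n + 1, z, v => z = v ∨ ∃ z', P.WeakStep z z' ∧ P.Reach n z' v

theorem Reach.succ {P : PolyData d f} {n : ℕ} {z v : Fin d → ℝ} (h : P.Reach n z v) :
    P.Reach (n + 1) z v := by
  induction n generalizing z with
  | zero => exact Or.inl h
  | succ n ih =>
    rcases h with h | ⟨z', hs, hr⟩
    · exact Or.inl h
    · exact Or.inr ⟨z', hs, ih hr⟩

theorem Reach.refl (P : PolyData d f) (n : ℕ) (z : Fin d → ℝ) : P.Reach n z z := by
  cases n with
  | zero => exact rfl
  | succ n => exact Or.inl rfl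

theorem WeakStep.reach {P : PolyData d f} {n : ℕ} {z z' v : Fin d → ℝ} (h : P.WeakStep z z')
    (hr : P.Reach n z' v) : P.Reach (n + 1) z v := Or.inr ⟨z', h, hr⟩

theorem Reach.exists_walk {P : PolyData d f} {n : ℕ} {z v : Fin d → ℝ} (hz : z ∈ P.toSet)
    (h : P.Reach n z v) : ∃ k ≤ n, ∃ y : Fin (k + 1) → Fin d → ℝ,
      P.IsCircuitWalk y ∧ y 0 = z ∧ y (Fin.last k) = v := by
  have triv : ∀ n : ℕ, z = v → ∃ k ≤ n, ∃ y : Fin (k + 1) → Fin d → ℝ,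
      P.IsCircuitWalk y ∧ y 0 = z ∧ y (Fin.last k) = v := fun n hzv =>
    ⟨0, n.zero_le, fun _ => z, ⟨fun _ => hz, fun i => i.elim0⟩, rfl, hzv⟩
  induction n generalizing z with
  | zero => exact triv 0 h
  | succ n ih =>
    rcases h with h | ⟨z', ⟨hz', g, hg, α, hα, rfl, i, hi, hiz⟩, hr⟩
    · exact triv _ h
    · obtain ⟨k, hk, y, hy, hy0, hyk⟩ := ih hz' hr fun n hzv =>
        ⟨0, n.zero_le, fun _ => z + α • g, ⟨fun _ => hz', fun i => i.elim0⟩, rfl, hzv⟩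
      rcases hα.eq_or_lt with rfl | hα
      · exact ⟨k, hk.trans n.le_succ, y, hy, by simpa using hy0, hyk⟩
      · refine ⟨k + 1, Nat.succ_le_succ hk, Fin.cons z y, ⟨?_, ?_⟩, rfl, ?_⟩
        · intro j
          refine Fin.cases ?_ (fun j => ?_) j
          · simpa using hz
          · simpa using hy.1 j
        · intro j
          refine Fin.cases ?_ (fun j => ?_) j
          · refine ⟨g, hg, α, hα, ?_, fun β hβ hmem => ?_⟩
            · simp [hy0]
            · have h1 := hmem i
              simp only [Fin.castSucc_zero, Fin.cons_zero, eval_add, eval_smul] at h1 hiz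
              nlinarith [mul_pos (sub_pos.2 hβ) (neg_pos.2 hi)]
          · obtain ⟨g', hg', α', hα', h1, h2⟩ := hy.2 j
            refine ⟨g', hg', α', hα', ?_, ?_⟩
            · simpa [Fin.cons_succ, ← Fin.succ_castSucc] using h1
            · simpa [← Fin.succ_castSucc] using h2
        · rw [← Fin.succ_last, Fin.cons_succ, hyk]

theorem Reach.circuitDistance_le {P : PolyData d f} {n : ℕ} {z v : Fin d → ℝ}
    (hz : z ∈ P.toSet) (h : P.Reach n z v) : P.circuitDistance z v ≤ n := by
  obtain ⟨k, hk, y, hy⟩ := h.exists_walk hz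
  have h1 : P.circuitDistance z v ≤ (k : ℕ∞) := sInf_le ⟨k, rfl, y, hy⟩
  exact h1.trans (by exact_mod_cast hk)

/-- Moving in a direction that decreases some slack, one is eventually stopped by a facet. -/
theorem exists_blocking (P : PolyData d f) {z g : Fin d → ℝ} (hz : z ∈ P.toSet)
    (hg : ∃ i, P.eval i g < 0) : ∃ α : ℝ, 0 ≤ α ∧ z + α • g ∈ P.toSet ∧
      ∃ i, P.eval i g < 0 ∧ P.eval i (z + α • g) = P.rhs i := by
  classical
  obtain ⟨i, hi, hmin⟩ := (Finset.univ.filter fun i => P.eval i g < 0).exists_min_image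
    (fun i => (P.eval i z - P.rhs i) / (-P.eval i g)) (by simpa [Finset.Nonempty] using hg)
  simp only [Finset.mem_filter, Finset.mem_univ, true_and] at hi hmin
  have hα : 0 ≤ (P.eval i z - P.rhs i) / (-P.eval i g) :=
    div_nonneg (sub_nonneg.2 (hz i)) (neg_pos.2 hi).le
  refine ⟨_, hα, fun k => ?_, i, hi, ?_⟩
  · rw [eval_add, eval_smul]
    rcases lt_or_ge (P.eval k g) 0 with hk | hk
    · have := (le_div_iff₀ (neg_pos.2 hk)).1 (hmin k hk)
      linarith
    · have := mul_nonneg hα hk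
      have := hz k
      linarith
  · rw [eval_add, eval_smul]
    field_simp [hi.ne]
    ring

/-- A vertex `v` of a polyhedron together with a plane through `v`, the common zero set of the
slacks in `C`, with coordinates the slacks of two facets `a`, `b` through `v`, and the
corresponding edge directions `da`, `db`. -/
structure PlaneAt (P : PolyData d f) (C : Set (Fin f)) (a b : Fin f)
    (v da db : Fin d → ℝ) : Prop where
  mem : v ∈ P.toSet
  inj : ∀ x, (∀ k ∈ C, P.eval k x = 0) → P.eval a x = 0 → P.eval b x = 0 → x = 0
  vC : ∀ k ∈ C, P.eval k v = P.rhs k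
  va : P.eval a v = P.rhs a
  vb : P.eval b v = P.rhs b
  daC : ∀ k ∈ C, P.eval k da = 0
  daa : P.eval a da = 1
  dab : P.eval b da = 0
  dbC : ∀ k ∈ C, P.eval k db = 0
  dba : P.eval a db = 0
  dbb : P.eval b db = 1

namespace PlaneAt

variable {P : PolyData d f} {C : Set (Fin f)} {a b : Fin f} {v da db : Fin d → ℝ}

theorem symm (h : P.PlaneAt C a b v da db) : P.PlaneAt C b a v db da where
  mem := h.mem
  inj x hC hb ha := h.inj x hC ha hb
  vC := h.vC
  va := h.vb
  vb := h.va
  daC := h.dbC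
  daa := h.dbb
  dab := h.dba
  dbC := h.daC
  dba := h.dab
  dbb := h.daa

theorem eq_comb (h : P.PlaneAt C a b v da db) {x : Fin d → ℝ} (hx : ∀ k ∈ C, P.eval k x = 0) :
    x = P.eval a x • da + P.eval b x • db := by
  rw [← sub_eq_zero]
  apply h.inj
  · intro k hk
    simp [eval_sub, eval_add, eval_smul, hx k hk, h.daC k hk, h.dbC k hk]
  · simp [eval_sub, eval_add, eval_smul, h.daa, h.dba]
  · simp [eval_sub, eval_add, eval_smul, h.dab, h.dbb]

theorem eq_point (h : P.PlaneAt C a b v da db) {p : Fin d → ℝ}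
    (hp : ∀ k ∈ C, P.eval k p = P.rhs k) :
    p = v + (P.eval a p - P.rhs a) • da + (P.eval b p - P.rhs b) • db := by
  have := h.eq_comb (x := p - v) fun k hk => by rw [eval_sub, hp k hk, h.vC k hk, sub_self]
  rw [eval_sub, eval_sub, h.va, h.vb] at this
  rw [add_assoc, ← this]
  abel

theorem isCircuit (h : P.PlaneAt C a b v da db) {e : Fin f} {s t : ℝ}
    (hst : s ≠ 0 ∨ t ≠ 0) (he : P.eval e da ≠ 0 ∨ P.eval e db ≠ 0)
    (h0 : s * P.eval e da + t * P.eval e db = 0) : P.IsCircuit (s • da + t • db) := by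
  have ea : P.eval a (s • da + t • db) = s := by simp [eval_add, eval_smul, h.daa, h.dba]
  have eb : P.eval b (s • da + t • db) = t := by simp [eval_add, eval_smul, h.dab, h.dbb]
  refine P.isCircuit_of_kernel ?_ (insert e C) ?_ ?_
  · intro hz
    rw [hz, eval_zero] at ea eb
    rcases hst with hs | ht
    · exact hs ea.symm
    · exact ht eb.symm
  · rintro k (rfl | hk)
    · rw [eval_add, eval_smul, eval_smul, h0]
    · simp [eval_add, eval_smul, h.daC k hk, h.dbC k hk]
  · intro x hx
    have hxr := h.eq_comb fun k hk => hx k (Set.mem_insert_of_mem _ hk)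
    have hxe := hx e (Set.mem_insert _ _)
    set X := P.eval a x
    set Y := P.eval b x
    rw [hxr, eval_add, eval_smul, eval_smul] at hxe
    have hdet : X * t = Y * s := by
      rcases he with he | he
      · apply mul_right_cancel₀ he
        linear_combination t * hxe - Y * h0
      · apply mul_right_cancel₀ he
        linear_combination (-s) * hxe + X * h0
    rcases hst with hs | ht
    · refine ⟨X / s, ?_⟩
      rw [hxr, smul_add, smul_smul, smul_smul]
      congr 2 <;> field_simp
      linarith
    · refine ⟨Y / t, ?_⟩
      rw [hxr, smul_add, smul_smul, smul_smul]
      congr 2 <;> field_simp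
      linarith

theorem eval_point (_ : P.PlaneAt C a b v da db) (k : Fin f) (s t : ℝ) :
    P.eval k (v + s • da + t • db) = P.eval k v + s * P.eval k da + t * P.eval k db := by
  simp only [eval_add, eval_smul]

/-- Moving parallel to the facet `e` inside the plane until blocked by the facet `k`. -/
theorem reach_step (h : P.PlaneAt C a b v da db) {w : Fin d → ℝ} {n : ℕ} {s t s' t' : ℝ}
    (e : Fin f) (he : P.eval e da ≠ 0 ∨ P.eval e db ≠ 0)
    (hpar : (s' - s) * P.eval e da + (t' - t) * P.eval e db = 0)
    (hmem : v + s' • da + t' • db ∈ P.toSet) (k : Fin f)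
    (hk : P.eval k (v + s' • da + t' • db) = P.rhs k)
    (hdec : (s' = s ∧ t' = t) ∨ (s' - s) * P.eval k da + (t' - t) * P.eval k db < 0)
    (hr : P.Reach n (v + s' • da + t' • db) w) :
    P.Reach (n + 1) (v + s • da + t • db) w := by
  by_cases heq : s' = s ∧ t' = t
  · obtain ⟨rfl, rfl⟩ := heq
    exact hr.succ
  · have hdec := hdec.resolve_left heq
    refine WeakStep.reach ⟨hmem, (s' - s) • da + (t' - t) • db, ?_, 1, zero_le_one, ?_, k, ?_, hk⟩ hr
    · refine h.isCircuit (e := e) ?_ he hpar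
      by_contra hcon
      push Not at hcon
      exact heq ⟨sub_eq_zero.1 hcon.1, sub_eq_zero.1 hcon.2⟩
    · module
    · rwa [eval_add, eval_smul, eval_smul]

/-- A point of the edge `a` of the plane reaches `v` in one step. -/
theorem reach_edge (h : P.PlaneAt C a b v da db) {t : ℝ} (ht : 0 ≤ t) :
    P.Reach 1 (v + (0 : ℝ) • da + t • db) v := by
  refine h.reach_step (s' := 0) (t' := 0) (w := v) (n := 0) a (Or.inl (by simp [h.daa]))
    (by simp [h.dba]) (by simpa using h.mem) b (by simp [h.vb]) ?_ (by simp [Reach])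
  rcases ht.eq_or_lt with rfl | ht
  · simp
  · right
    simp [h.dbb, ht]

/-- Moving parallel to `e` until the edge `a` is reached. -/
theorem reach_via_edge (h : P.PlaneAt C a b v da db) {s t t' : ℝ} (hs : 0 ≤ s) (ht' : 0 ≤ t')
    (e : Fin f) (he : P.eval e db ≠ 0)
    (hpar : (0 - s) * P.eval e da + (t' - t) * P.eval e db = 0)
    (hmem : v + (0 : ℝ) • da + t' • db ∈ P.toSet) : P.Reach 2 (v + s • da + t • db) v := by
  refine h.reach_step e (Or.inr he) hpar hmem a ?_ ?_ (h.reach_edge ht')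
  · rw [h.eval_point]
    simp [h.va, h.dba]
  · rcases hs.eq_or_lt with rfl | hs
    · left
      refine ⟨rfl, ?_⟩
      have : t' - t = 0 := by simpa [he] using hpar
      linarith
    · right
      simp [h.daa, h.dba, hs]

/-- Moving parallel to `b` to the edge `a` works whenever the target is feasible; otherwise the
edge `a` is bounded, and no facet blocking it is active at the starting point. -/
theorem reach_or_blocked (h : P.PlaneAt C a b v da db) {s t : ℝ} (hs : 0 ≤ s) (ht : 0 ≤ t) :
    P.Reach 2 (v + s • da + t • db) v ∨ ∃ q, 0 ≤ q ∧ q < t ∧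
      v + (0 : ℝ) • da + q • db ∈ P.toSet ∧
      (∃ k, P.eval k db < 0 ∧ P.eval k (v + (0 : ℝ) • da + q • db) = P.rhs k) ∧
      ∀ k, P.eval k db < 0 → P.eval k (v + (0 : ℝ) • da + q • db) = P.rhs k →
        P.eval k (v + s • da + t • db) ≠ P.rhs k := by
  by_cases hfe : v + (0 : ℝ) • da + t • db ∈ P.toSet
  · exact Or.inl (h.reach_via_edge hs ht b (by simp [h.dbb]) (by simp [h.dab]) hfe)
  have hneg : ∃ i, P.eval i db < 0 := by
    by_contra hcon
    push Not at hcon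
    refine hfe fun i => ?_
    rw [h.eval_point]
    have := h.mem i
    have := mul_nonneg ht (hcon i)
    linarith
  obtain ⟨q, hq, hqP, k, hk, hkq⟩ := P.exists_blocking h.mem hneg
  have hqt : q < t := by
    by_contra hcon
    push Not at hcon
    refine hfe fun i => ?_
    have h1 := hqP i
    have h2 := h.mem i
    rw [h.eval_point]
    rw [eval_add, eval_smul] at h1
    rcases le_total 0 (P.eval i db) with hi | hi
    · nlinarith [mul_nonneg ht hi]
    · nlinarith [mul_le_mul_of_nonpos_right hcon hi]
  have e0 : v + (0 : ℝ) • da + q • db = v + q • db := by simp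
  by_cases hcase : ∃ k, P.eval k db < 0 ∧ P.eval k (v + q • db) = P.rhs k ∧
      P.eval k (v + s • da + t • db) = P.rhs k
  · obtain ⟨k', hk', h1, h2⟩ := hcase
    refine Or.inl (h.reach_via_edge hs hq k' hk'.ne ?_ (by rwa [e0]))
    rw [h.eval_point] at h2
    rw [eval_add, eval_smul] at h1
    linarith
  · push Not at hcase
    refine Or.inr ⟨q, hq, hqt, by rwa [e0], ⟨k, hk, by rwa [e0]⟩, fun k hk hkq => ?_⟩
    exact hcase k hk (by rwa [e0] at hkq)

theorem point_swap (v da db : Fin d → ℝ) (s t : ℝ) :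
    v + s • da + t • db = v + t • db + s • da := add_right_comm _ _ _

/-- Move from a point of the plane in a circuit direction. If points on the facets in `G` are known
to reach `v` in two steps, then three steps suffice unless the step is blocked by `l` or `o`. -/
theorem reach_three_or_blocked (h : P.PlaneAt C a b v da db) {s t : ℝ}
    (hp : v + s • da + t • db ∈ P.toSet) {G : Set (Fin f)} {l o : Fin f}
    (hG : ∀ s' t' : ℝ, v + s' • da + t' • db ∈ P.toSet → ∀ k ∈ G,
      P.eval k (v + s' • da + t' • db) = P.rhs k → P.Reach 2 (v + s' • da + t' • db) v)
    (hcov : ∀ k, k ∈ C ∨ k ∈ G ∨ k = l ∨ k = o)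
    (σ τ : ℝ) (r : Fin f) (hr : P.eval r da ≠ 0 ∨ P.eval r db ≠ 0)
    (hpar : σ * P.eval r da + τ * P.eval r db = 0)
    (hdec : ∃ k, σ * P.eval k da + τ * P.eval k db < 0) :
    P.Reach 3 (v + s • da + t • db) v ∨ ∃ α, 0 ≤ α ∧
      v + (s + α * σ) • da + (t + α * τ) • db ∈ P.toSet ∧ ∃ k, (k = l ∨ k = o) ∧
      σ * P.eval k da + τ * P.eval k db < 0 ∧
      P.eval k (v + (s + α * σ) • da + (t + α * τ) • db) = P.rhs k := by
  have heg : ∀ k, P.eval k (σ • da + τ • db) = σ * P.eval k da + τ * P.eval k db := fun k => by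
    simp only [eval_add, eval_smul]
  obtain ⟨α, hα, hmem, k, hk, hkz⟩ := P.exists_blocking hp (g := σ • da + τ • db)
    (by simpa only [heg] using hdec)
  rw [heg] at hk
  have hz : v + s • da + t • db + α • (σ • da + τ • db)
      = v + (s + α * σ) • da + (t + α * τ) • db := by module
  rw [hz] at hmem hkz
  rcases hcov k with hkC | hkG | hk'
  · rw [h.daC k hkC, h.dbC k hkC] at hk
    simp at hk
  · left
    refine h.reach_step r hr (by linear_combination α * hpar) hmem k hkz ?_ (hG _ _ hmem k hkG hkz)
    rcases hα.eq_or_lt with rfl | hα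
    · simp
    · right
      have := mul_neg_of_pos_of_neg hα hk
      linarith
  · exact Or.inr ⟨α, hα, hmem, k, hk', hk, hkz⟩

theorem coords_nonneg (h : P.PlaneAt C a b v da db) {s t : ℝ}
    (hp : v + s • da + t • db ∈ P.toSet) : 0 ≤ s ∧ 0 ≤ t := by
  have h1 := hp a
  have h2 := hp b
  rw [h.eval_point] at h1 h2
  simp only [h.va, h.vb, h.daa, h.dab, h.dba, h.dbb] at h1 h2
  exact ⟨by linarith, by linarith⟩

/-- The case of `reach_three` in which the facet `l` runs along a recession direction, with the
edge `a` on the side of `l` containing `v`. -/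
theorem reach_three_of_slope_pos (h : P.PlaneAt C a b v da db) {s t : ℝ}
    (hp : v + s • da + t • db ∈ P.toSet) {G : Set (Fin f)} {l o e : Fin f}
    (hG : ∀ s' t' : ℝ, v + s' • da + t' • db ∈ P.toSet → ∀ k ∈ G,
      P.eval k (v + s' • da + t' • db) = P.rhs k → P.Reach 2 (v + s' • da + t' • db) v)
    (hcov : ∀ k, k ∈ C ∨ k ∈ G ∨ k = l ∨ k = o) (haG : a ∈ G) (hbG : b ∈ G)
    {q : ℝ} (hqP : v + (0 : ℝ) • da + q • db ∈ P.toSet)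
    (heq : P.eval e (v + (0 : ℝ) • da + q • db) = P.rhs e) (heb : P.eval e db < 0)
    (hea : 0 < P.eval e da)
    (hl : P.eval l (v + s • da + t • db) = P.rhs l) (hlv : P.rhs l < P.eval l v)
    (hla : 0 < P.eval l da) (hlb : P.eval l db < 0) :
    P.Reach 3 (v + s • da + t • db) v := by
  by_contra hno
  have key := fun σ τ r hr hpar hdec =>
    (h.reach_three_or_blocked hp hG hcov σ τ r hr hpar hdec).resolve_left hno
  obtain ⟨α₂, hα₂, hz₂, k₂, hk₂, hk₂d, hk₂z⟩ := key (P.eval l db) (-P.eval l da) l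
    (Or.inl hla.ne') (by ring) ⟨a, by simpa [h.daa, h.dba] using hlb⟩
  obtain rfl : k₂ = o := by
    rcases hk₂ with rfl | rfl
    · linarith
    · rfl
  have hrec : 0 ≤ -P.eval l db * P.eval e da + P.eval l da * P.eval e db := by
    by_contra hcon
    push Not at hcon
    obtain ⟨α, hα, hz, k, hk, hkd, hkz⟩ := key (-P.eval l db) (P.eval l da) l
      (Or.inl hla.ne') (by ring) ⟨e, hcon⟩
    rcases hk with rfl | rfl
    · linarith
    · linarith
  obtain ⟨α₁, hα₁, hz₁, k₁, hk₁, hk₁d, hk₁z⟩ := key (P.eval e db) (-P.eval e da) e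
    (Or.inl hea.ne') (by ring) ⟨a, by simpa [h.daa, h.dba] using heb⟩
  obtain rfl : k₁ = k₂ := by
    rcases hk₁ with rfl | rfl
    · linarith
    · rfl
  obtain ⟨hs₁, ht₁⟩ := h.coords_nonneg hz₁
  obtain ⟨hs₂, ht₂⟩ := h.coords_nonneg hz₂
  have he₁ := hz₁ e
  have hl₂ := hz₂ l
  have hoQ := hqP k₁
  have hov := h.mem k₁
  have hstep : ∀ g ∈ G, P.eval g (v + (s + α₁ * P.eval e db) • da +
      (t + α₁ * -P.eval e da) • db) ≠ P.rhs g := by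
    intro g hg hgz
    refine hno (h.reach_step e (Or.inl hea.ne') (by ring) hz₁ k₁ hk₁z ?_ (hG _ _ hz₁ g hg hgz))
    rcases hα₁.eq_or_lt with rfl | hα₁
    · simp
    · right
      have := mul_neg_of_pos_of_neg hα₁ hk₁d
      linarith
  have hsne := hstep a haG
  have htne := hstep b hbG
  have hl₂z : P.eval l (v + (s + α₂ * P.eval l db) • da +
      (t + α₂ * -P.eval l da) • db) = P.rhs l := by
    rw [h.eval_point] at hl ⊢
    linear_combination hl
  rw [h.eval_point] at he₁ hl₂ hoQ hk₁z hk₂z hsne htne hl₂z heq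
  simp only [h.va, h.vb, h.daa, h.dab, h.dba, h.dbb] at hsne htne
  generalize s + α₁ * P.eval e db = s₁ at *
  generalize t + α₁ * -P.eval e da = t₁ at *
  generalize s + α₂ * P.eval l db = s₂ at *
  generalize t + α₂ * -P.eval l da = t₂ at *
  have hs₁p : 0 < s₁ := lt_of_le_of_ne hs₁ fun h0 => hsne (by rw [← h0]; ring)
  have ht₁p : 0 < t₁ := lt_of_le_of_ne ht₁ fun h0 => htne (by rw [← h0]; ring)
  generalize P.eval k₁ da = A at *
  generalize P.eval k₁ db = B at *
  generalize P.eval e da = Ae at *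
  generalize P.eval e db = Be at *
  generalize P.eval l da = Al at *
  generalize P.eval l db = Bl at *
  rcases lt_or_ge B 0 with hB | hB
  · nlinarith [mul_nonneg_of_nonpos_of_nonpos heb.le (show s₁ * A + (t₁ - q) * B ≤ 0 by linarith),
      mul_neg_of_pos_of_neg hs₁p hk₁d,
      mul_nonneg (neg_nonneg.2 hB.le) (show 0 ≤ s₁ * Ae + (t₁ - q) * Be by linarith)]
  · rcases lt_or_ge A 0 with hA | hA
    · have hBpos : 0 < B := by
        rcases hB.eq_or_lt with rfl | hB
        · nlinarith [mul_pos_of_neg_of_neg hlb hA]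
        · exact hB
      nlinarith [mul_pos hBpos (sub_pos.2 hlv), mul_nonneg (neg_nonneg.2 hlb.le) (sub_nonneg.2 hov),
        mul_nonneg hs₂ (neg_nonneg.2 hk₂d.le)]
    · have h1 := mul_nonneg hs₁p.le hA
      have h2 := mul_nonneg ht₁p.le hB
      obtain rfl : A = 0 := by
        have : s₁ * A = 0 := by linarith
        exact (mul_eq_zero.1 this).resolve_left hs₁p.ne'
      obtain rfl : B = 0 := by
        have : t₁ * B = 0 := by linarith
        exact (mul_eq_zero.1 this).resolve_left ht₁p.ne'
      simp at hk₁d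

/-- A point of the plane lying on a facet `l` not containing `v` reaches `v` in three steps, if at
most one facet besides `C`, `a`, `b`, `l` and two further ones is relevant to the plane. -/
theorem reach_three (h : P.PlaneAt C a b v da db) {s t : ℝ}
    (hp : v + s • da + t • db ∈ P.toSet) {l : Fin f} (hlC : l ∉ C)
    (hl : P.eval l (v + s • da + t • db) = P.rhs l) (hlv : P.rhs l < P.eval l v)
    (hcov : ∀ e e', e ∉ C → e' ∉ C → e ≠ a → e ≠ b → e' ≠ a → e' ≠ b → e ≠ e' → e ≠ l → e' ≠ l →
      ∃ o, ∀ k, k ∈ C ∨ k = a ∨ k = b ∨ k = e ∨ k = e' ∨ k = l ∨ k = o) :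
    P.Reach 3 (v + s • da + t • db) v := by
  obtain ⟨hs, ht⟩ := h.coords_nonneg hp
  rcases h.reach_or_blocked hs ht with h2 | ⟨q, hq, hqt, hqP, ⟨e, heb, heq⟩, hne⟩
  · exact h2.succ
  have hr := h.symm.reach_or_blocked ht hs
  rw [← point_swap] at hr
  rcases hr with h2 | ⟨q', hq', hqs, hqP', ⟨e', hea', heq'⟩, hne'⟩
  · exact h2.succ
  have he := hne e heb heq
  have he' := hne' e' hea' heq'
  have hpe := hp e
  have hpe' := hp e'
  rw [h.eval_point] at hpe hpe' hl
  have heq0 := heq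
  have heq0' := heq'
  rw [h.eval_point] at heq0
  rw [h.symm.eval_point] at heq0'
  have hea : 0 < P.eval e da := by
    have h1 := mul_neg_of_pos_of_neg (sub_pos.2 hqt) heb
    have hs0 : 0 < s := hq'.trans_lt hqs
    by_contra hcon
    have := mul_nonpos_of_nonpos_of_nonneg (not_lt.1 hcon) hs0.le
    nlinarith
  have heb' : 0 < P.eval e' db := by
    have h1 := mul_neg_of_pos_of_neg (sub_pos.2 hqs) hea'
    have ht0 : 0 < t := hq.trans_lt hqt
    by_contra hcon
    have := mul_nonpos_of_nonpos_of_nonneg (not_lt.1 hcon) ht0.le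
    nlinarith
  have hee' : e ≠ e' := by
    rintro rfl
    linarith
  obtain ⟨o, ho⟩ := hcov e e' (fun hc => by linarith [h.daC e hc])
    (fun hc => by linarith [h.dbC e' hc])
    (by rintro rfl; linarith [h.dba]) (by rintro rfl; linarith [h.dab])
    (by rintro rfl; linarith [h.dba]) (by rintro rfl; linarith [h.dab]) hee'
    (by rintro rfl; rw [h.eval_point] at he; exact he hl)
    (by rintro rfl; rw [h.eval_point] at he'; exact he' hl)
  set G : Set (Fin f) := {a, b, e, e'} with hGdef
  have hG : ∀ s' t' : ℝ, v + s' • da + t' • db ∈ P.toSet → ∀ k ∈ G,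
      P.eval k (v + s' • da + t' • db) = P.rhs k → P.Reach 2 (v + s' • da + t' • db) v := by
    intro s' t' hm k hk hkz
    obtain ⟨hs', ht'⟩ := h.coords_nonneg hm
    rcases hk with rfl | rfl | rfl | rfl
    · rw [h.eval_point, h.va, h.daa, h.dba] at hkz
      obtain rfl : s' = 0 := by linarith
      exact (h.reach_edge ht').succ
    · rw [h.eval_point, h.vb, h.dab, h.dbb] at hkz
      obtain rfl : t' = 0 := by linarith
      rw [point_swap]
      exact (h.symm.reach_edge hs').succ
    · rw [h.eval_point] at hkz
      exact h.reach_via_edge hs' hq k heb.ne (by linarith) hqP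
    · rw [h.eval_point] at hkz
      rw [point_swap]
      exact h.symm.reach_via_edge ht' hq' k hea'.ne (by linarith) hqP'
  have hcov' : ∀ k, k ∈ C ∨ k ∈ G ∨ k = l ∨ k = o := fun k => by
    simp only [hGdef, Set.mem_insert_iff, Set.mem_singleton_iff]
    have := ho k
    tauto
  rcases lt_or_ge 0 (P.eval l da) with hla | hla
  · rcases lt_or_ge (P.eval l db) 0 with hlb | hlb
    · exact h.reach_three_of_slope_pos hp hG hcov' (by simp [hGdef]) (by simp [hGdef]) hqP heq heb
        hea (by rwa [h.eval_point]) hlv hla hlb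
    · nlinarith [mul_nonneg hs hla.le, mul_nonneg ht hlb]
  · rcases lt_or_ge 0 (P.eval l db) with hlb | hlb
    · rcases hla.eq_or_lt with hla | hla
      · rw [hla] at hl
        nlinarith [mul_nonneg ht hlb.le]
      · rw [point_swap] at hp ⊢
        refine h.symm.reach_three_of_slope_pos hp (G := G) (fun s' t' hm k hk hkz => ?_) hcov'
          (by simp [hGdef]) (by simp [hGdef]) hqP' heq' hea' heb'
          (by rw [h.symm.eval_point]; linarith) hlv hlb hla
        rw [point_swap] at hm hkz ⊢
        exact hG _ _ hm k hk hkz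
    · have hlne : P.eval l da ≠ 0 ∨ P.eval l db ≠ 0 := by
        by_contra hcon
        push Not at hcon
        rw [hcon.1, hcon.2] at hl
        linarith
      have dec₁ : ∃ k, P.eval l db * P.eval k da + -P.eval l da * P.eval k db < 0 := by
        rcases hlb.eq_or_lt with h0 | h0
        · refine ⟨e, ?_⟩
          have : P.eval l da < 0 := lt_of_le_of_ne hla fun h1 => hlne.elim (· h1) (· h0)
          rw [h0]
          nlinarith [mul_pos_of_neg_of_neg this heb]
        · exact ⟨a, by simpa [h.daa, h.dba] using h0⟩
      have dec₂ : ∃ k, -P.eval l db * P.eval k da + P.eval l da * P.eval k db < 0 := by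
        rcases hla.eq_or_lt with h0 | h0
        · refine ⟨e', ?_⟩
          have : P.eval l db < 0 := lt_of_le_of_ne hlb fun h1 => hlne.elim (· h0) (· h1)
          rw [h0]
          nlinarith [mul_pos_of_neg_of_neg this hea']
        · exact ⟨b, by simpa [h.dab, h.dbb] using h0⟩
      rcases h.reach_three_or_blocked hp hG hcov' _ _ l hlne (by ring) dec₁ with
        h3 | ⟨-, -, -, k, hk, hkd, -⟩
      · exact h3
      rcases h.reach_three_or_blocked hp hG hcov' _ _ l hlne (by ring) dec₂ with
        h3 | ⟨-, -, -, k', hk', hkd', -⟩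
      · exact h3
      rcases hk with rfl | rfl
      · linarith
      · rcases hk' with rfl | rfl
        · linarith
        · linarith

end PlaneAt

/-- A basis `x` of rows active at the feasible point `u`, with the dual basis `e`. -/
structure FrameAt (P : PolyData d f) (x : Fin 4 → Fin f) (u : Fin d → ℝ)
    (e : Fin 4 → Fin d → ℝ) : Prop where
  mem : u ∈ P.toSet
  act : ∀ i, P.eval (x i) u = P.rhs (x i)
  dual : ∀ i l, P.eval (x i) (e l) = if i = l then 1 else 0
  inj : ∀ z, (∀ i, P.eval (x i) z = 0) → z = 0

namespace FrameAt

variable {P : PolyData d f} {x : Fin 4 → Fin f} {u : Fin d → ℝ} {e : Fin 4 → Fin d → ℝ}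

theorem dual_self (h : P.FrameAt x u e) (i : Fin 4) : P.eval (x i) (e i) = 1 := by
  simp [h.dual]

theorem dual_ne (h : P.FrameAt x u e) {i l : Fin 4} (hil : i ≠ l) :
    P.eval (x i) (e l) = 0 := by
  simp [h.dual, hil]

theorem eq_sum (h : P.FrameAt x u e) (g : Fin d → ℝ) :
    g = ∑ i, P.eval (x i) g • e i := by
  rw [← sub_eq_zero]
  refine h.inj _ fun i => ?_
  simp [eval_sub, eval_sum, eval_smul, h.dual]

theorem eval_dir (h : P.FrameAt x u e) (k : Fin f) (g : Fin d → ℝ) :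
    P.eval k g = ∑ i, P.eval (x i) g * P.eval k (e i) := by
  conv_lhs => rw [h.eq_sum g]
  simp [eval_sum, eval_smul]

theorem eval_pt (h : P.FrameAt x u e) (k : Fin f) (z : Fin d → ℝ) :
    P.eval k z = P.eval k u + ∑ i, (P.eval (x i) z - P.rhs (x i)) * P.eval k (e i) := by
  have := h.eval_dir k (z - u)
  simp only [eval_sub, h.act] at this
  linarith

theorem injective (h : P.FrameAt x u e) : Function.Injective x := by
  intro i l hil
  by_contra hne
  have := h.dual_ne hne
  rw [hil, h.dual_self] at this
  exact one_ne_zero this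

theorem planeAt (h : P.FrameAt x u e) {a b : Fin 4} (hab : a ≠ b) :
    P.PlaneAt {k | ∃ m, m ≠ a ∧ m ≠ b ∧ k = x m} (x a) (x b) u (e a) (e b) where
  mem := h.mem
  inj z hC ha hb := h.inj z fun i => by
    by_cases hia : i = a
    · rwa [hia]
    by_cases hib : i = b
    · rwa [hib]
    exact hC _ ⟨i, hia, hib, rfl⟩
  vC := by
    rintro _ ⟨m, -, -, rfl⟩
    exact h.act m
  va := h.act a
  vb := h.act b
  daC := by
    rintro _ ⟨m, hm, -, rfl⟩
    exact h.dual_ne hm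
  daa := h.dual_self a
  dab := h.dual_ne hab.symm
  dbC := by
    rintro _ ⟨m, -, hm, rfl⟩
    exact h.dual_ne hm
  dba := h.dual_ne hab
  dbb := h.dual_self b

/-- A direction is a circuit if it is the kernel of two rows of the frame and a further row. -/
theorem isCircuit (h : P.FrameAt x u e) {i l : Fin 4} (hil : i ≠ l) (k : Fin f) {s t : ℝ}
    (hst : s ≠ 0 ∨ t ≠ 0) (hk : P.eval k (e i) ≠ 0 ∨ P.eval k (e l) ≠ 0)
    (h0 : s * P.eval k (e i) + t * P.eval k (e l) = 0) : P.IsCircuit (s • e i + t • e l) :=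
  (h.planeAt hil).isCircuit hst hk h0

theorem isCircuit_dir (h : P.FrameAt x u e) (i : Fin 4) : P.IsCircuit (e i) := by
  obtain ⟨l, hl⟩ := exists_ne i
  have := h.isCircuit hl.symm (x l) (s := 1) (t := 0) (by simp) (by simp [h.dual_self])
    (by simp [h.dual_ne hl])
  simpa using this

end FrameAt

theorem exists_others (i l : Fin 4) (hil : i ≠ l) : ∃ m n, i ≠ m ∧ i ≠ n ∧ l ≠ m ∧ l ≠ n ∧ m ≠ n ∧
    ∀ k, k = i ∨ k = l ∨ k = m ∨ k = n := by
  decide +revert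

theorem exists_fourth (i l m : Fin 4) (hil : i ≠ l) (hmi : m ≠ i) (hml : m ≠ l) :
    ∃ n, n ≠ i ∧ n ≠ l ∧ n ≠ m ∧ ∀ k, k = i ∨ k = l ∨ k = m ∨ k = n := by
  obtain ⟨p, q, hip, hiq, hlp, hlq, hpq, hall⟩ := exists_others i l hil
  rcases hall m with rfl | rfl | rfl | rfl
  · exact absurd rfl hmi
  · exact absurd rfl hml
  · exact ⟨q, hiq.symm, hlq.symm, hpq.symm, hall⟩
  · exact ⟨p, hip.symm, hlp.symm, hpq, fun k => by have := hall k; tauto⟩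

theorem sum_four {i l m n : Fin 4} (hil : i ≠ l) (him : i ≠ m) (hin : i ≠ n) (hlm : l ≠ m)
    (hln : l ≠ n) (hmn : m ≠ n) (F : Fin 4 → ℝ) : ∑ k, F k = F i + F l + F m + F n := by
  have : (Finset.univ : Finset (Fin 4)) = {i, l, m, n} := by
    symm
    rw [← Finset.card_eq_iff_eq_univ]
    simp [hil, him, hin, hlm, hln, hmn]
  rw [this, Finset.sum_insert (by simp [hil, him, hin]), Finset.sum_insert (by simp [hlm, hln]),
    Finset.sum_insert (by simp [hmn]), Finset.sum_singleton]
  ring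

/-- Two feasible points `u`, `v` at complementary frames of rows, in a polyhedron without further
rows. -/
structure Opposite (P : PolyData d f) (x y : Fin 4 → Fin f) (u v : Fin d → ℝ)
    (e δ : Fin 4 → Fin d → ℝ) : Prop where
  X : P.FrameAt x u e
  Y : P.FrameAt y v δ
  xv : ∀ i, P.rhs (x i) < P.eval (x i) v
  yu : ∀ j, P.rhs (y j) < P.eval (y j) u
  cov : ∀ k, (∃ i, k = x i) ∨ ∃ j, k = y j

/-- The ray from `u` in direction `g` contains a feasible point on the facet `k`. -/
def Hits (P : PolyData d f) (u g : Fin d → ℝ) (k : Fin f) (τ : ℝ) : Prop :=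
  0 ≤ τ ∧ u + τ • g ∈ P.toSet ∧ P.eval k (u + τ • g) = P.rhs k

namespace Hits

variable {P : PolyData d f} {u g : Fin d → ℝ} {k : Fin f} {τ : ℝ}

theorem eq (h : P.Hits u g k τ) : P.eval k u + τ * P.eval k g = P.rhs k := by
  rw [← h.2.2, eval_add, eval_smul]

theorem eval_neg (h : P.Hits u g k τ) (hu : P.rhs k < P.eval k u) : P.eval k g < 0 := by
  by_contra hcon
  have := mul_nonneg h.1 (not_lt.1 hcon)
  linarith [h.eq]

theorem pos (h : P.Hits u g k τ) (hu : P.rhs k < P.eval k u) : 0 < τ := by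
  refine lt_of_le_of_ne h.1 fun h0 => ?_
  have := h.eq
  rw [← h0] at this
  linarith

theorem weakStep (h : P.Hits u g k τ) (hu : P.rhs k < P.eval k u) (hg : P.IsCircuit g) :
    P.WeakStep u (u + τ • g) :=
  ⟨h.2.1, g, hg, τ, h.1, rfl, k, h.eval_neg hu, h.2.2⟩

/-- Two facets first hit by the same ray are hit at the same point. -/
theorem unique {k' : Fin f} {τ' : ℝ} (h : P.Hits u g k τ) (hu : P.rhs k < P.eval k u)
    (h' : P.Hits u g k' τ') (hu' : P.rhs k' < P.eval k' u) : τ = τ' := by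
  have h1 := h.eval_neg hu
  have h2 := h'.eval_neg hu'
  have h3 := h.2.1 k'
  have h4 := h'.2.1 k
  have h5 := h.eq
  have h6 := h'.eq
  rw [eval_add, eval_smul] at h3 h4
  apply le_antisymm
  · by_contra hcon
    nlinarith [mul_neg_of_pos_of_neg (sub_pos.2 (not_le.1 hcon)) h2]
  · by_contra hcon
    nlinarith [mul_neg_of_pos_of_neg (sub_pos.2 (not_le.1 hcon)) h1]

end Hits

namespace Opposite

variable {P : PolyData d f} {x y : Fin 4 → Fin f} {u v : Fin d → ℝ} {e δ : Fin 4 → Fin d → ℝ}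

/-- The point `Z` of the two-face at `u` spanned by `e i` and `e l` lies on the facets `y j` and
`y a`, and is two steps away from `u`. -/
structure TwoSteps (P : PolyData d f) (x y : Fin 4 → Fin f) (u v : Fin d → ℝ)
    (i l j a : Fin 4) (Z : Fin d → ℝ) : Prop where
  ne : i ≠ l
  ne' : j ≠ a
  mem : Z ∈ P.toSet
  onX : ∀ m, m ≠ i → m ≠ l → P.eval (x m) Z = P.rhs (x m)
  onj : P.eval (y j) Z = P.rhs (y j)
  ona : P.eval (y a) Z = P.rhs (y a)
  reach : P.Reach 2 Z v → P.Reach 4 u v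

theorem exists_twoSteps (h : P.Opposite x y u v e δ) {i l j a₀ : Fin 4} {τ : ℝ}
    (hi : P.Hits u (e i) (y j) τ) (hl : ∀ τ', ¬ P.Hits u (e l) (y j) τ')
    (hs : -P.eval (y j) (e i) * P.eval (y a₀) (e l)
      + P.eval (y j) (e l) * P.eval (y a₀) (e i) < 0) :
    ∃ a Z, TwoSteps P x y u v i l j a Z := by
  have hil : i ≠ l := by
    rintro rfl
    exact hl τ hi
  have hη := hi.eval_neg (h.yu j)
  set η := P.eval (y j) (e i) with hηdef
  set θ := P.eval (y j) (e l) with hθdef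
  have heg : ∀ k, P.eval k (θ • e i + -η • e l) = θ * P.eval k (e i) + -η * P.eval k (e l) :=
    fun k => by simp only [eval_add, eval_smul]
  obtain ⟨α, hα, hmem, k, hk, hkz⟩ := P.exists_blocking hi.2.1 (g := θ • e i + -η • e l)
    ⟨y a₀, by rw [heg]; linarith⟩
  have hc : P.IsCircuit (θ • e i + -η • e l) := h.X.isCircuit hil (y j)
    (Or.inr (neg_ne_zero.2 hη.ne)) (Or.inl hη.ne) (by rw [← hηdef, ← hθdef]; ring)
  have hstep : P.WeakStep (u + τ • e i) (u + τ • e i + α • (θ • e i + -η • e l)) :=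
    ⟨hmem, _, hc, α, hα, rfl, k, hk, hkz⟩
  have hj : P.eval (y j) (u + τ • e i + α • (θ • e i + -η • e l)) = P.rhs (y j) := by
    rw [eval_add, hi.2.2, eval_smul, heg]
    simp only [← hηdef, ← hθdef]
    ring
  have hX : ∀ m, m ≠ i → m ≠ l →
      P.eval (x m) (u + τ • e i + α • (θ • e i + -η • e l)) = P.rhs (x m) := by
    intro m hmi hml
    simp only [eval_add, eval_smul, h.X.act, h.X.dual_ne hmi, h.X.dual_ne hml]
    ring
  rcases h.cov k with ⟨m, rfl⟩ | ⟨a, rfl⟩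
  · exfalso
    rw [heg] at hk
    by_cases hmi : m = i
    · subst hmi
      rw [h.X.dual_self, h.X.dual_ne hil] at hk
      have h1 : τ + α * θ = 0 := by
        simp only [eval_add, eval_smul, h.X.act, h.X.dual_ne hil, h.X.dual_self] at hkz
        linarith
      have h2 : u + τ • e m + α • (θ • e m + -η • e l) = u + (α * -η) • e l := by
        have : u + τ • e m + α • (θ • e m + -η • e l)
          = u + (τ + α * θ) • e m + (α * -η) • e l := by module
        rw [this, h1]
        simp
      exact hl (α * -η) ⟨mul_nonneg hα (neg_nonneg.2 hη.le), by rwa [← h2], by rwa [← h2]⟩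
    · rw [h.X.dual_ne hmi] at hk
      by_cases hml : m = l
      · subst hml
        rw [h.X.dual_self] at hk
        linarith
      · rw [h.X.dual_ne hml] at hk
        linarith
  · refine ⟨a, _, hil, ?_, hmem, hX, hj, hkz, fun hr => ?_⟩
    · rintro rfl
      rw [heg, ← hηdef, ← hθdef] at hk
      linarith
    · exact (hi.weakStep (h.yu j) (h.X.isCircuit_dir i)).reach (hstep.reach hr)

variable {i l j a : Fin 4} {Z : Fin d → ℝ}

theorem hits_of_not_reach (h : P.Opposite x y u v e δ) (hno : ¬ P.Reach 4 u v)
    (hZ : TwoSteps P x y u v i l j a Z) {b : Fin 4} (hbj : b ≠ j) (hba : b ≠ a) :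
    (∃ s q, (s = i ∨ s = l) ∧ P.Hits v (δ b) (x s) q) ∧
    ∀ s q, P.Hits v (δ b) (x s) q → (s = i ∨ s = l) ∧ q < P.eval (y b) Z - P.rhs (y b) := by
  obtain ⟨c, hcj, hca, hcb, hall⟩ : ∃ c, c ≠ j ∧ c ≠ a ∧ c ≠ b ∧
      ∀ k, k = j ∨ k = a ∨ k = b ∨ k = c := exists_fourth j a b hZ.ne' hbj hba
  have hp := h.Y.planeAt hcb
  have hZv : Z = v + (P.eval (y c) Z - P.rhs (y c)) • δ c
      + (P.eval (y b) Z - P.rhs (y b)) • δ b := hp.eq_point <| by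
    rintro _ ⟨m, hmc, hmb, rfl⟩
    rcases hall m with rfl | rfl | rfl | rfl
    · exact hZ.onj
    · exact hZ.ona
    · exact absurd rfl hmb
    · exact absurd rfl hmc
  have hs := sub_nonneg.2 (hZ.mem (y c))
  have ht := sub_nonneg.2 (hZ.mem (y b))
  rcases hp.reach_or_blocked hs ht with hr | ⟨q₀, hq₀, hqt, hqP, ⟨k, hk, hkq⟩, hne⟩
  · rw [← hZv] at hr
    exact absurd (hZ.reach hr) hno
  rw [zero_smul, add_zero] at hqP hkq hne
  rw [← hZv] at hne
  have hx : ∀ s, P.Hits v (δ b) (x s) q₀ → s = i ∨ s = l := by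
    intro s hs
    by_contra hcon
    push Not at hcon
    exact hne _ (hs.eval_neg (h.xv s)) hs.2.2 (hZ.onX s hcon.1 hcon.2)
  have hkx : ∃ s, P.Hits v (δ b) (x s) q₀ := by
    rcases h.cov k with ⟨s, rfl⟩ | ⟨m, rfl⟩
    · exact ⟨s, hq₀, hqP, hkq⟩
    · rw [h.Y.dual] at hk
      split_ifs at hk <;> linarith
  obtain ⟨s₀, hs₀⟩ := hkx
  refine ⟨⟨s₀, q₀, hx s₀ hs₀, hs₀⟩, fun s q hsq => ?_⟩
  obtain rfl := hsq.unique (h.xv s) hs₀ (h.xv s₀)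
  exact ⟨hx s hsq, hqt⟩

theorem hits_ne (h : P.Opposite x y u v e δ) (hno : ¬ P.Reach 4 u v)
    (hZ : TwoSteps P x y u v i l j a Z) {b c : Fin 4} (hbj : b ≠ j) (hba : b ≠ a) (hcj : c ≠ j)
    (hca : c ≠ a) (hbc : b ≠ c) {s : Fin 4} {q q' : ℝ} (hb : P.Hits v (δ b) (x s) q)
    (hc : P.Hits v (δ c) (x s) q') : False := by
  have hqb := ((h.hits_of_not_reach hno hZ hbj hba).2 s q hb).2
  have hqc := ((h.hits_of_not_reach hno hZ hcj hca).2 s q' hc).2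
  have hZs := hZ.mem (x s)
  rw [h.Y.eval_pt, sum_four hZ.ne' hbj.symm hcj.symm hba.symm hca.symm hbc, hZ.onj, hZ.ona] at hZs
  have hb0 := hb.eval_neg (h.xv s)
  have hc0 := hc.eval_neg (h.xv s)
  have h1 := mul_lt_mul_of_neg_right hqb hb0
  have h2 := mul_lt_mul_of_neg_right hqc hc0
  linarith [hb.eq, hc.eq, h.xv s]

theorem slope_pos {w B C q Zb Zc : ℝ} (hw : 0 < w) (hq : 0 < q) (h1 : w + B * q = 0)
    (hqZ : q < Zb) (hZc : 0 ≤ Zc) (h3 : 0 ≤ w + B * Zb + C * Zc) : 0 < C ∧ 0 < Zc := by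
  have hB : B < 0 := by nlinarith
  have hpos : 0 < C * Zc := by nlinarith
  rcases hZc.eq_or_lt with rfl | hZc
  · simp at hpos
  · exact ⟨pos_of_mul_pos_left hpos hZc.le, hZc⟩

theorem slope_le {w w' B B' C C' q Zb Zc : ℝ} (hw : 0 < w) (hw' : 0 < w') (hq : 0 < q)
    (h1 : w + B * q = 0) (h2 : 0 ≤ w' + B' * q) (hqZ : q < Zb) (hZc : 0 < Zc) (hC' : 0 < C')
    (h3 : 0 ≤ w + B * Zb + C * Zc) (h4 : w' + B' * Zb + C' * Zc = 0) :
    C' * w ≤ -B' * q * C := by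
  have hB : B < 0 := by nlinarith
  have hB' : B' < 0 := by nlinarith [mul_pos hC' hZc]
  have h5 : w * Zb ≤ w * q + C * q * Zc := by nlinarith
  have h6 := mul_le_mul_of_nonneg_left h5 (neg_nonneg.2 hB'.le)
  have h7 := mul_nonneg hw.le h2
  have h8 : (C' * w) * Zc ≤ (-B' * q * C) * Zc := by nlinarith
  exact le_of_mul_le_mul_right h8 hZc

/-- Two facets whose traces in a three-dimensional cone cross as described have proportional
slacks on that cone. -/
theorem slopes_proportional {w₁ w₂ A₁ A₂ B₁ B₂ C₁ C₂ q₁ q₂ Zb Zc Za' Zc' : ℝ}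
    (hw₁ : 0 < w₁) (hw₂ : 0 < w₂) (hq₁ : 0 < q₁) (hq₂ : 0 < q₂)
    (h₁ : w₁ + B₁ * q₁ = 0) (h₂ : w₂ + A₂ * q₂ = 0)
    (h₁' : 0 ≤ w₂ + B₂ * q₁) (h₂' : 0 ≤ w₁ + A₁ * q₂)
    (hZb : q₁ < Zb) (hZc : 0 ≤ Zc) (hZa' : q₂ < Za') (hZc' : 0 ≤ Zc')
    (hZ₁ : 0 ≤ w₁ + B₁ * Zb + C₁ * Zc) (hZ₂ : w₂ + B₂ * Zb + C₂ * Zc = 0)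
    (hZ₂' : 0 ≤ w₂ + A₂ * Za' + C₂ * Zc') (hZ₁' : w₁ + A₁ * Za' + C₁ * Zc' = 0) :
    A₁ * w₂ = A₂ * w₁ ∧ B₁ * w₂ = B₂ * w₁ ∧ C₁ * w₂ = C₂ * w₁ := by
  obtain ⟨hC₁, hZc⟩ := slope_pos hw₁ hq₁ h₁ hZb hZc hZ₁
  obtain ⟨hC₂, hZc'⟩ := slope_pos hw₂ hq₂ h₂ hZa' hZc' hZ₂'
  have le₁ := slope_le hw₁ hw₂ hq₁ h₁ h₁' hZb hZc hC₂ hZ₁ hZ₂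
  have le₂ := slope_le hw₂ hw₁ hq₂ h₂ h₂' hZa' hZc' hC₁ hZ₂' hZ₁'
  have m₁ := mul_nonneg h₁' hC₁.le
  have m₂ := mul_nonneg h₂' hC₂.le
  have hC : C₁ * w₂ = C₂ * w₁ := by linarith
  have hβ : w₂ + B₂ * q₁ = 0 :=
    (mul_eq_zero.1 (show (w₂ + B₂ * q₁) * C₁ = 0 by linarith)).resolve_right hC₁.ne'
  have hα : w₁ + A₁ * q₂ = 0 :=
    (mul_eq_zero.1 (show (w₁ + A₁ * q₂) * C₂ = 0 by linarith)).resolve_right hC₂.ne'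
  refine ⟨mul_right_cancel₀ hq₂.ne' ?_, mul_right_cancel₀ hq₁.ne' ?_, hC⟩
  · linear_combination w₂ * hα - w₁ * h₂
  · linear_combination w₂ * h₁ - w₁ * hβ

theorem not_twoSteps_twoSteps (h : P.Opposite x y u v e δ) (hno : ¬ P.Reach 4 u v)
    {l' a' : Fin 4} {Z' : Fin d → ℝ} (hη : P.eval (y j) (e i) ≠ 0)
    (hZ : TwoSteps P x y u v i l j a Z) (hZ' : TwoSteps P x y u v i l' j a' Z')
    (hll' : l ≠ l') : False := by
  rcases eq_or_ne a a' with rfl | haa'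
  · obtain ⟨b, c, hjb, hjc, hab, hac, hbc, -⟩ := exists_others j a hZ.ne'
    have key : ∀ b, j ≠ b → a ≠ b → ∃ q, P.Hits v (δ b) (x i) q := by
      intro b hjb hab
      obtain ⟨⟨s, q, -, hs⟩, h1⟩ := h.hits_of_not_reach hno hZ hjb.symm hab.symm
      have h2 := (h.hits_of_not_reach hno hZ' hjb.symm hab.symm).2 s q hs
      rcases (h1 s q hs).1 with rfl | rfl
      · exact ⟨q, hs⟩
      · rcases h2.1 with rfl | h2
        · exact ⟨q, hs⟩
        · exact absurd h2 hll'
    obtain ⟨q, hq⟩ := key b hjb hab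
    obtain ⟨q', hq'⟩ := key c hjc hac
    exact h.hits_ne hno hZ hjb.symm hab.symm hjc.symm hac.symm hbc hq hq'
  · obtain ⟨c, hcj, hca, hca', -⟩ := exists_fourth j a a' hZ.ne' hZ'.ne'.symm haa'.symm
    have hic : ∃ q, P.Hits v (δ c) (x i) q := by
      obtain ⟨⟨s, q, -, hs⟩, h1⟩ := h.hits_of_not_reach hno hZ hcj hca
      have h2 := (h.hits_of_not_reach hno hZ' hcj hca').2 s q hs
      rcases (h1 s q hs).1 with rfl | rfl
      · exact ⟨q, hs⟩
      · rcases h2.1 with rfl | h2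
        · exact ⟨q, hs⟩
        · exact absurd h2 hll'
    obtain ⟨q, hq⟩ := hic
    have hl : ∃ q₁, P.Hits v (δ a') (x l) q₁ ∧ q₁ < P.eval (y a') Z - P.rhs (y a') := by
      obtain ⟨⟨s, q₁, -, hs⟩, h1⟩ := h.hits_of_not_reach hno hZ hZ'.ne'.symm haa'.symm
      obtain ⟨rfl | rfl, hlt⟩ := h1 s q₁ hs
      · exact (h.hits_ne hno hZ hZ'.ne'.symm haa'.symm hcj hca hca'.symm hs hq).elim
      · exact ⟨q₁, hs, hlt⟩
    have hl' : ∃ q₂, P.Hits v (δ a) (x l') q₂ ∧ q₂ < P.eval (y a) Z' - P.rhs (y a) := by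
      obtain ⟨⟨s, q₂, -, hs⟩, h1⟩ := h.hits_of_not_reach hno hZ' hZ.ne'.symm haa'
      obtain ⟨rfl | rfl, hlt⟩ := h1 s q₂ hs
      · exact (h.hits_ne hno hZ' hZ.ne'.symm haa' hcj hca' hca.symm hs hq).elim
      · exact ⟨q₂, hs, hlt⟩
    obtain ⟨q₁, hq₁, hlt₁⟩ := hl
    obtain ⟨q₂, hq₂, hlt₂⟩ := hl'
    have hsum := sum_four hZ.ne' hZ'.ne' hcj.symm haa' hca.symm hca'.symm
    have hZl := hZ.mem (x l)
    have hZl' := hZ.onX l' hZ'.ne.symm hll'.symm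
    have hZl₂ := hZ'.onX l hZ.ne.symm hll'
    have hZl₂' := hZ'.mem (x l')
    have hf₁ := hq₁.2.1 (x l')
    have hf₂ := hq₂.2.1 (x l)
    rw [h.Y.eval_pt, hsum, hZ.onj, hZ.ona] at hZl hZl'
    rw [h.Y.eval_pt, hsum, hZ'.onj, hZ'.ona] at hZl₂ hZl₂'
    rw [eval_add, eval_smul] at hf₁ hf₂
    obtain ⟨hA, hB, hC⟩ := slopes_proportional (sub_pos.2 (h.xv l)) (sub_pos.2 (h.xv l'))
      (hq₁.pos (h.xv l)) (hq₂.pos (h.xv l')) (B₁ := P.eval (x l) (δ a'))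
      (A₂ := P.eval (x l') (δ a)) (B₂ := P.eval (x l') (δ a')) (A₁ := P.eval (x l) (δ a))
      (C₁ := P.eval (x l) (δ c)) (C₂ := P.eval (x l') (δ c))
      (by linarith [hq₁.eq]) (by linarith [hq₂.eq]) (by linarith) (by linarith) hlt₁
      (sub_nonneg.2 (hZ.mem (y c))) hlt₂ (sub_nonneg.2 (hZ'.mem (y c)))
      (by linarith) (by linarith) (by linarith) (by linarith)
    set g := P.eval (y j) (e l) • e i + -P.eval (y j) (e i) • e l with hg
    have gj : P.eval (y j) g = 0 := by
      simp only [hg, eval_add, eval_smul]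
      ring
    have gl : P.eval (x l) g = -P.eval (y j) (e i) := by
      simp [hg, eval_add, eval_smul, eval_neg, h.X.dual_self, h.X.dual_ne hZ.ne.symm]
    have gl' : P.eval (x l') g = 0 := by
      simp [hg, eval_add, eval_smul, eval_neg, h.X.dual_ne hZ'.ne.symm, h.X.dual_ne hll'.symm]
    rw [h.Y.eval_dir, hsum, gj] at gl gl'
    have : -P.eval (y j) (e i) * (P.eval (x l') v - P.rhs (x l')) = 0 := by
      linear_combination (P.eval (x l) v - P.rhs (x l)) * gl'
        - (P.eval (x l') v - P.rhs (x l')) * gl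
        + P.eval (y a) g * hA + P.eval (y a') g * hB + P.eval (y c) g * hC
    exact (mul_ne_zero (neg_ne_zero.2 hη) (sub_pos.2 (h.xv l')).ne') this

/-- The slack of `y d` along the facet `y j`, as seen from the point of the edge directions at `u`
hitting `y j` where that slack is least. -/
theorem exists_slope_neg_or (h : P.Opposite x y u v e δ) {j b : Fin 4}
    (hj : ∃ i τ, P.Hits u (e i) (y j) τ) {Z : Fin d → ℝ} (hZ : Z ∈ P.toSet)
    (hZj : P.eval (y j) Z = P.rhs (y j)) (hZb : P.eval (y b) Z = P.rhs (y b)) :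
    (∃ i l, (∃ τ, P.Hits u (e i) (y j) τ) ∧ (∀ τ, ¬ P.Hits u (e l) (y j) τ) ∧
      P.eval (x l) Z ≠ P.rhs (x l) ∧ -P.eval (y j) (e i) * P.eval (y b) (e l)
        + P.eval (y j) (e l) * P.eval (y b) (e i) < 0) ∨
    ∀ g, P.eval (y j) g = 0 → (∀ l, P.eval (x l) Z = P.rhs (x l) → P.eval (x l) g = 0) →
      P.eval (y b) g = 0 := by
  classical
  rw [or_iff_not_imp_left]
  intro hnot g hgj hgx
  obtain ⟨i, hi, hmin⟩ := (Finset.univ.filter fun i => ∃ τ, P.Hits u (e i) (y j) τ).exists_min_image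
    (fun i => P.eval (y b) (e i) / -P.eval (y j) (e i)) (by simpa [Finset.Nonempty] using hj)
  simp only [Finset.mem_filter, Finset.mem_univ, true_and] at hi hmin
  obtain ⟨τ, hτ⟩ := hi
  have hη := hτ.eval_neg (h.yu j)
  have hS : ∀ l, P.eval (x l) Z ≠ P.rhs (x l) → 0 ≤ -P.eval (y j) (e i) * P.eval (y b) (e l)
        + P.eval (y j) (e l) * P.eval (y b) (e i) := by
    intro l hl
    by_cases hlK : ∃ τ, P.Hits u (e l) (y j) τ
    · have h1 := hmin l hlK
      obtain ⟨τ', hτ'⟩ := hlK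
      have hη' := hτ'.eval_neg (h.yu j)
      rw [div_le_div_iff₀ (neg_pos.2 hη) (neg_pos.2 hη')] at h1
      linarith
    · push Not at hlK
      by_contra hcon
      exact hnot ⟨i, l, ⟨τ, hτ⟩, hlK, hl, not_le.1 hcon⟩
  set S : Fin 4 → ℝ := fun l => -P.eval (y j) (e i) * P.eval (y b) (e l)
        + P.eval (y j) (e l) * P.eval (y b) (e i) with hSdef
  have hterm : ∀ l, 0 ≤ S l * (P.eval (x l) Z - P.rhs (x l)) := by
    intro l
    by_cases hl : P.eval (x l) Z = P.rhs (x l)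
    · simp [hl]
    · exact mul_nonneg (hS l hl) (sub_nonneg.2 (hZ _))
  have hsum : ∑ l, S l * (P.eval (x l) Z - P.rhs (x l)) ≤ 0 := by
    have h1 := h.X.eval_pt (y b) Z
    have h2 := h.X.eval_pt (y j) Z
    have h3 : ∑ l, S l * (P.eval (x l) Z - P.rhs (x l))
        = -P.eval (y j) (e i) * ∑ l, (P.eval (x l) Z - P.rhs (x l)) * P.eval (y b) (e l)
        + P.eval (y b) (e i) * ∑ l, (P.eval (x l) Z - P.rhs (x l)) * P.eval (y j) (e l) := by
      rw [Finset.mul_sum, Finset.mul_sum, ← Finset.sum_add_distrib]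
      exact Finset.sum_congr rfl fun l _ => by simp only [hSdef]; ring
    have h4 := hτ.eq
    have h5 := hτ.2.1 (y b)
    rw [eval_add, eval_smul] at h5
    have hb : ∑ l, (P.eval (x l) Z - P.rhs (x l)) * P.eval (y b) (e l)
        = P.rhs (y b) - P.eval (y b) u := by linarith
    have hj : ∑ l, (P.eval (x l) Z - P.rhs (x l)) * P.eval (y j) (e l)
        = τ * P.eval (y j) (e i) := by linarith
    rw [h3, hb, hj]
    nlinarith [mul_nonneg (neg_nonneg.2 hη.le) (sub_nonneg.2 h5)]
  have hzero : ∀ l, S l * (P.eval (x l) Z - P.rhs (x l)) = 0 := fun l =>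
    (Finset.sum_eq_zero_iff_of_nonneg fun l _ => hterm l).1
      (le_antisymm hsum (Finset.sum_nonneg fun l _ => hterm l)) l (Finset.mem_univ l)
  have hSg : ∑ l, S l * P.eval (x l) g = 0 := Finset.sum_eq_zero fun l _ => by
    rcases mul_eq_zero.1 (hzero l) with h0 | h0
    · rw [h0, zero_mul]
    · rw [hgx l (sub_eq_zero.1 h0), mul_zero]
  have h3 : ∑ l, S l * P.eval (x l) g
      = -P.eval (y j) (e i) * P.eval (y b) g + P.eval (y b) (e i) * P.eval (y j) g := by
    rw [h.X.eval_dir (y b) g, h.X.eval_dir (y j) g, Finset.mul_sum, Finset.mul_sum,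
      ← Finset.sum_add_distrib]
    exact Finset.sum_congr rfl fun l _ => by simp only [hSdef]; ring
  rw [hSg, hgj, mul_zero, add_zero] at h3
  exact (mul_eq_zero.1 h3.symm).resolve_left (neg_ne_zero.2 hη.ne)

theorem reach_four (h : P.Opposite x y u v e δ) : P.Reach 4 u v := by
  by_contra hno
  obtain ⟨j, hj⟩ : ∃ j i τ, P.Hits u (e i) (y j) τ := by
    have hneg : ∃ i, P.eval (y 0) (e i) < 0 := by
      by_contra hcon
      push Not at hcon
      have h1 := h.X.eval_pt (y 0) v
      have h2 : 0 ≤ ∑ i, (P.eval (x i) v - P.rhs (x i)) * P.eval (y 0) (e i) :=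
        Finset.sum_nonneg fun i _ => mul_nonneg (sub_pos.2 (h.xv i)).le (hcon i)
      linarith [h.Y.act 0, h.yu 0]
    obtain ⟨i, hi⟩ := hneg
    obtain ⟨τ, hτ, hmem, k, hk, hkz⟩ := P.exists_blocking h.X.mem ⟨_, hi⟩
    rcases h.cov k with ⟨m, rfl⟩ | ⟨j, rfl⟩
    · rw [h.X.dual] at hk
      split_ifs at hk <;> linarith
    · exact ⟨j, i, τ, hτ, hmem, hkz⟩
  obtain ⟨b₀, hb₀⟩ := exists_ne j
  obtain ⟨i, l, ⟨τ, hi⟩, hl, -, hs⟩ | halt :=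
    h.exists_slope_neg_or hj h.Y.mem (h.Y.act j) (h.Y.act b₀)
  swap
  · have := halt (δ b₀) (h.Y.dual_ne hb₀.symm) fun l hl => absurd hl (h.xv l).ne'
    rw [h.Y.dual_self] at this
    exact one_ne_zero this
  obtain ⟨a, Z, hZ⟩ := h.exists_twoSteps hi hl hs
  obtain ⟨b, c, q, q', hjb, hjc, hab, hac, hbc, hall, hb, hc⟩ : ∃ b c q q', j ≠ b ∧ j ≠ c ∧ a ≠ b ∧
      a ≠ c ∧ b ≠ c ∧ (∀ k, k = j ∨ k = a ∨ k = b ∨ k = c) ∧ P.Hits v (δ b) (x i) q ∧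
      P.Hits v (δ c) (x l) q' := by
    obtain ⟨b, c, hjb, hjc, hab, hac, hbc, hall⟩ := exists_others j a hZ.ne'
    obtain ⟨⟨s, q, hs, hsq⟩, -⟩ := h.hits_of_not_reach hno hZ hjb.symm hab.symm
    obtain ⟨⟨s', q', hs', hsq'⟩, -⟩ := h.hits_of_not_reach hno hZ hjc.symm hac.symm
    have hne : s ≠ s' := by
      rintro rfl
      exact h.hits_ne hno hZ hjb.symm hab.symm hjc.symm hac.symm hbc hsq hsq'
    rcases hs with rfl | rfl <;> rcases hs' with rfl | rfl
    · exact absurd rfl hne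
    · exact ⟨b, c, q, q', hjb, hjc, hab, hac, hbc, hall, hsq, hsq'⟩
    · exact ⟨c, b, q', q, hjc, hjb, hac, hab, hbc.symm, fun k => by have := hall k; tauto, hsq', hsq⟩
    · exact absurd rfl hne
  have hQ : ∀ k, k ≠ c → P.eval (y k) (v + q' • δ c) = P.rhs (y k) := fun k hk => by
    rw [eval_add, eval_smul, h.Y.act, h.Y.dual_ne hk, mul_zero, add_zero]
  obtain ⟨i₂, l₂, ⟨τ₂, hi₂⟩, hl₂, hl₂Q, hs₂⟩ | halt :=
    h.exists_slope_neg_or hj hc.2.1 (hQ j hjc) (hQ a hac)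
  swap
  · have hneg := hc.eval_neg (h.xv l)
    have := halt (P.eval (x l) (δ c) • δ a - P.eval (x l) (δ a) • δ c)
      (by simp [eval_sub, eval_smul, h.Y.dual_ne hZ.ne', h.Y.dual_ne hjc]) fun s hs => by
        have hsc : P.Hits v (δ c) (x s) q' := ⟨hc.1, hc.2.1, hs⟩
        rcases ((h.hits_of_not_reach hno hZ hjc.symm hac.symm).2 s q' hsc).1 with rfl | rfl
        · exact (h.hits_ne hno hZ hjb.symm hab.symm hjc.symm hac.symm hbc hb hsc).elim
        · simp only [eval_sub, eval_smul]
          ring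
    simp only [eval_sub, eval_smul, h.Y.dual_self, h.Y.dual_ne hac] at this
    linarith
  obtain ⟨a₂, Z₂, hZ₂⟩ := h.exists_twoSteps hi₂ hl₂ hs₂
  have hll₂ : l ≠ l₂ := by
    rintro rfl
    exact hl₂Q hc.2.2
  rcases eq_or_ne i i₂ with rfl | hii₂
  · exact h.not_twoSteps_twoSteps hno (hi.eval_neg (h.yu j)).ne hZ hZ₂ hll₂
  obtain ⟨m, hmj, hma, hma₂⟩ : ∃ m, m ≠ j ∧ m ≠ a ∧ m ≠ a₂ := by
    rcases eq_or_ne a a₂ with rfl | haa₂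
    · exact ⟨b, hjb.symm, hab.symm, hab.symm⟩
    · obtain ⟨m, h1, h2, h3, -⟩ := exists_fourth j a a₂ hZ.ne' hZ₂.ne'.symm haa₂.symm
      exact ⟨m, h1, h2, h3⟩
  obtain ⟨⟨s, q, hs, hsq⟩, -⟩ := h.hits_of_not_reach hno hZ hmj hma
  rcases hs with rfl | rfl <;>
    rcases ((h.hits_of_not_reach hno hZ₂ hmj hma₂).2 _ q hsq).1 with rfl | rfl
  · exact hii₂ rfl
  · exact hl₂ _ hi
  · exact hl _ hi₂
  · exact hll₂ rfl

end Opposite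

/-- Two distinct rows of a frame are independent. -/
theorem FrameAt.linearIndepOn_pair {P : PolyData d f} {x : Fin 4 → Fin f} {u : Fin d → ℝ}
    {e : Fin 4 → Fin d → ℝ} (h : P.FrameAt x u e) {i l : Fin 4} (hil : i ≠ l) :
    LinearIndepOn ℝ P.row {x i, x l} := by
  have key : ∀ c c' : ℝ, c • P.row (x i) + c' • P.row (x l) = 0 →
      ∀ z, c * P.eval (x i) z + c' * P.eval (x l) z = 0 := fun c c' hc z => by
    have := congrArg (fun r => ∑ j, r j * z j) hc
    simpa [add_mul, Finset.sum_add_distrib, mul_assoc, ← Finset.mul_sum, eval] using this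
  rw [LinearIndepOn.pair_iff _ (h.injective.ne hil)]
  intro c c' hc
  have h1 := key c c' hc (e i)
  have h2 := key c c' hc (e l)
  rw [h.dual_self, h.dual_ne hil.symm] at h1
  rw [h.dual_self, h.dual_ne hil] at h2
  constructor <;> linarith

/-- An independent set of active rows at a vertex extends to a frame. -/
theorem IsVertex.exists_frame {P : PolyData 4 f} {v : Fin 4 → ℝ} (hv : P.IsVertex v)
    {S : Set (Fin f)} (hS : S ⊆ P.activeAt v) (hli : LinearIndepOn ℝ P.row S) :
    ∃ y δ, P.FrameAt y v δ ∧ ∀ k ∈ S, ∃ i, y i = k := by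
  classical
  obtain ⟨B, hB, hSB, hspan, hBli⟩ := exists_linearIndepOn_extension hli hS
  have htop : ⊤ ≤ Submodule.span ℝ (Set.range fun k : B => P.row k) := by
    rw [← hv.2, show (Set.range fun k : B => P.row k) = P.row '' B by
      rw [Set.image_eq_range]]
    exact Submodule.span_le.2 hspan
  have hcard : Fintype.card B = Fintype.card (Fin 4) := by
    have := Module.finrank_eq_card_basis (Module.Basis.mk hBli htop)
    rw [Module.finrank_fin_fun] at this
    simp [← this]
  obtain ⟨φ⟩ : Nonempty (Fin 4 ≃ B) := ⟨(Fintype.equivOfCardEq hcard).symm⟩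
  set M : Matrix (Fin 4) (Fin 4) ℝ := fun i => P.row (φ i) with hM
  have hMu : IsUnit M := by
    rw [← Matrix.linearIndependent_rows_iff_isUnit]
    exact hBli.comp φ φ.injective
  have hdet := (Matrix.isUnit_iff_isUnit_det M).1 hMu
  have hmul : ∀ i z, P.eval (φ i) z = (M.mulVec z) i := fun _ _ => rfl
  refine ⟨fun i => φ i, fun l => M⁻¹.mulVec (Pi.single l 1), ⟨hv.1, fun i => hB (φ i).2, ?_, ?_⟩, ?_⟩
  · intro i l
    rw [hmul, Matrix.mulVec_mulVec, Matrix.mul_nonsing_inv _ hdet, Matrix.one_mulVec,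
      Pi.single_apply]
  · intro z hz
    have h0 : M.mulVec z = 0 := funext fun i => hz i
    have := congrArg M⁻¹.mulVec h0
    rwa [Matrix.mulVec_mulVec, Matrix.nonsing_inv_mul _ hdet, Matrix.one_mulVec,
      Matrix.mulVec_zero] at this
  · intro k hk
    exact ⟨φ.symm ⟨k, hSB hk⟩, by simp⟩

theorem exists_eighth (s : Finset (Fin 8)) (hs : s.card = 7) : ∃ o, ∀ k, k ∈ s ∨ k = o := by
  obtain ⟨o, ho⟩ := Finset.card_eq_one.1
    (show sᶜ.card = 1 by rw [Finset.card_compl, hs, Fintype.card_fin])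
  refine ⟨o, fun k => ?_⟩
  by_cases hk : k ∈ s
  · exact Or.inl hk
  · exact Or.inr (by simpa [ho] using Finset.mem_compl.2 hk)

namespace FrameAt

variable {P : PolyData d 8} {y : Fin 4 → Fin 8} {v : Fin d → ℝ} {δ : Fin 4 → Fin d → ℝ}

/-- A point on two facets of a frame at `v` and on a facet not containing `v` is at distance at
most three from `v`. -/
theorem reach_three (h : P.FrameAt y v δ) {a b : Fin 4} (hab : a ≠ b) {p : Fin d → ℝ}
    (hp : p ∈ P.toSet) (hC : ∀ m, m ≠ a → m ≠ b → P.eval (y m) p = P.rhs (y m)) {l : Fin 8}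
    (hl : P.eval l p = P.rhs l) (hlv : P.rhs l < P.eval l v) : P.Reach 3 p v := by
  have hpl := h.planeAt hab
  have hpv := hpl.eq_point (p := p) (by rintro _ ⟨m, hma, hmb, rfl⟩; exact hC m hma hmb)
  have hly : ∀ m, l ≠ y m := by
    rintro m rfl
    exact hlv.ne' (h.act m)
  rw [hpv] at hp hl ⊢
  refine hpl.reach_three hp (fun ⟨m, _, _, hm⟩ => hly m hm) hl hlv ?_
  intro e e' heC heC' hea heb hea' heb' hee' hel hel'
  have hey : ∀ e : Fin 8, (e ∉ {k | ∃ m, m ≠ a ∧ m ≠ b ∧ k = y m}) → e ≠ y a → e ≠ y b →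
      e ∉ Finset.univ.image y := by
    intro e heC hea heb hey
    obtain ⟨m, -, rfl⟩ := Finset.mem_image.1 hey
    exact heC ⟨m, fun h => hea (by rw [h]), fun h => heb (by rw [h]), rfl⟩
  obtain ⟨o, ho⟩ := exists_eighth (insert e (insert e' (insert l (Finset.univ.image y)))) <| by
    rw [Finset.card_insert_of_notMem, Finset.card_insert_of_notMem, Finset.card_insert_of_notMem,
      Finset.card_image_of_injective _ h.injective, Finset.card_univ, Fintype.card_fin]
    · simpa using fun m => (hly m).symm
    · simpa [hel'] using hey e' heC' hea' heb'
    · simpa [hel, hee'] using hey e heC hea heb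
  refine ⟨o, fun k => ?_⟩
  rcases ho k with hk | hk
  · simp only [Finset.mem_insert, Finset.mem_image, Finset.mem_univ, true_and] at hk
    rcases hk with hk | hk | hk | ⟨m, rfl⟩
    · tauto
    · tauto
    · tauto
    · by_cases hma : m = a
      · simp [hma]
      by_cases hmb : m = b
      · simp [hmb]
      exact Or.inl ⟨m, hma, hmb, rfl⟩
  · tauto

end FrameAt

/-- The arithmetic behind `reach_four_of_common_facet`. -/
theorem slack_pos {ι : Type*} [Fintype ι] {S : ι → Prop} {Y₀ z₀ : ℝ} {w η ζ : ι → ℝ}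
    (hY₀ : 0 < Y₀) (hw : ∀ i, 0 ≤ w i) (hwS : ∀ i, ¬ S i → w i = 0)
    (hneg : ∀ i, S i → ζ i < 0 → 0 < Y₀ * -ζ i + z₀ * η i) (hpos : ∀ i, S i → 0 ≤ ζ i → 0 ≤ η i)
    (hmix : ∀ i k, S i → S k → ζ i < 0 → 0 < ζ k → 0 ≤ ζ k * η i + -ζ i * η k)
    (hz : 0 ≤ z₀ + ∑ i, w i * ζ i) : 0 < Y₀ + ∑ i, w i * η i := by
  classical
  obtain ⟨κ, hκ, hκ₀, hκη⟩ : ∃ κ : ℝ, 0 ≤ κ ∧ κ * z₀ < Y₀ ∧ ∀ i, S i → κ * ζ i ≤ η i := by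
    by_cases hex : ∃ i, S i ∧ η i < 0
    · obtain ⟨i, hi, hmax⟩ := (Finset.univ.filter fun i => S i ∧ η i < 0).exists_max_image
        (fun i => η i / ζ i) (by simpa [Finset.Nonempty] using hex)
      simp only [Finset.mem_filter, Finset.mem_univ, true_and] at hi hmax
      have hζ : ∀ i, S i → η i < 0 → ζ i < 0 := fun i hS hi => by
        by_contra hcon
        linarith [hpos i hS (not_lt.1 hcon)]
      have hζi := hζ i hi.1 hi.2
      refine ⟨η i / ζ i, (div_pos_of_neg_of_neg hi.2 hζi).le, ?_, fun k hk => ?_⟩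
      · have := hneg i hi.1 hζi
        rw [div_mul_eq_mul_div, div_lt_iff_of_neg hζi]
        linarith
      · rcases lt_or_ge (η k) 0 with hηk | hηk
        · have := hmax k ⟨hk, hηk⟩
          rwa [div_le_iff_of_neg (hζ k hk hηk)] at this
        · rcases lt_or_ge 0 (ζ k) with hζk | hζk
          · have := hmix i k hi.1 hk hζi hζk
            rw [div_mul_eq_mul_div, div_le_iff_of_neg hζi]
            linarith
          · exact (mul_nonpos_of_nonneg_of_nonpos (div_pos_of_neg_of_neg hi.2 hζi).le hζk).trans hηk
    · push Not at hex
      exact ⟨0, le_rfl, by simpa using hY₀, fun i hi => by simpa using hex i hi⟩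
  have h1 : κ * ∑ i, w i * ζ i ≤ ∑ i, w i * η i := by
    rw [Finset.mul_sum]
    refine Finset.sum_le_sum fun i _ => ?_
    by_cases hi : S i
    · have := mul_le_mul_of_nonneg_left (hκη i hi) (hw i)
      linarith
    · simp [hwS i hi]
  nlinarith

/-- Vertices whose frames share exactly one facet are at distance at most four. -/
theorem FrameAt.reach_four_of_common_facet {P : PolyData d 8} {x y : Fin 4 → Fin 8}
    {u v : Fin d → ℝ} {e δ : Fin 4 → Fin d → ℝ} (hX : P.FrameAt x u e) (hY : P.FrameAt y v δ)
    {m n : Fin 4} (hmn : x m = y n) (hxv : ∀ i, i ≠ m → P.rhs (x i) < P.eval (x i) v)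
    (hyu : ∀ j, j ≠ n → P.rhs (y j) < P.eval (y j) u) : P.Reach 4 u v := by
  by_contra hno
  have hgood : ∀ p, P.WeakStep u p → P.eval (x m) p = P.rhs (x m) →
      ∀ j, j ≠ n → P.eval (y j) p = P.rhs (y j) → ∀ l, l ≠ m →
      P.eval (x l) p = P.rhs (x l) → False := by
    intro p hs hm j hj hjp l hl hlp
    obtain ⟨a, b, hna, hnb, hja, hjb, hab, hall⟩ := exists_others n j hj.symm
    refine hno (hs.reach (hY.reach_three hab hs.1 (fun k hka hkb => ?_) hlp (hxv l hl)))
    rcases hall k with rfl | rfl | rfl | rfl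
    · rwa [← hmn]
    · exact hjp
    · exact absurd rfl hka
    · exact absurd rfl hkb
  obtain ⟨z, hz⟩ : ∃ z, ∀ k, (∃ i, k = x i) ∨ (∃ j, j ≠ n ∧ k = y j) ∨ k = z := by
    obtain ⟨z, hz⟩ := exists_eighth (Finset.univ.image x ∪ (Finset.univ.erase n).image y) <| by
      rw [Finset.card_union_of_disjoint, Finset.card_image_of_injective _ hX.injective,
        Finset.card_image_of_injective _ hY.injective, Finset.card_erase_of_mem (Finset.mem_univ n),
        Finset.card_univ, Fintype.card_fin]
      rw [Finset.disjoint_left]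
      intro k hkx hky
      obtain ⟨i, -, rfl⟩ := Finset.mem_image.1 hkx
      obtain ⟨j, hj, hji⟩ := Finset.mem_image.1 hky
      have := hyu j (Finset.mem_erase.1 hj).1
      rw [hji, hX.act] at this
      exact this.false
    refine ⟨z, fun k => ?_⟩
    rcases hz k with hk | hk
    · rcases Finset.mem_union.1 hk with hk | hk
      · obtain ⟨i, -, rfl⟩ := Finset.mem_image.1 hk
        exact Or.inl ⟨i, rfl⟩
      · obtain ⟨j, hj, rfl⟩ := Finset.mem_image.1 hk
        exact Or.inr (Or.inl ⟨j, (Finset.mem_erase.1 hj).1, rfl⟩)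
    · exact Or.inr (Or.inr hk)
  have hdir : ∀ i, i ≠ m → (∀ k, 0 ≤ P.eval k (e i)) ∨ (P.eval z (e i) < 0 ∧ ∀ j, j ≠ n →
      0 < (P.eval (y j) u - P.rhs (y j)) * -P.eval z (e i)
        + (P.eval z u - P.rhs z) * P.eval (y j) (e i)) := by
    intro i hi
    rw [or_iff_not_imp_left]
    intro hneg
    push Not at hneg
    obtain ⟨α, hα, hmem, k, hk, hkz⟩ := P.exists_blocking hX.mem hneg
    have hs : P.WeakStep u (u + α • e i) := ⟨hmem, e i, hX.isCircuit_dir i, α, hα, rfl, k, hk, hkz⟩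
    have hx : ∀ l, l ≠ i → P.eval (x l) (u + α • e i) = P.rhs (x l) := fun l hl => by
      rw [eval_add, eval_smul, hX.act, hX.dual_ne hl, mul_zero, add_zero]
    have hy : ∀ j, j ≠ n → P.eval (y j) (u + α • e i) ≠ P.rhs (y j) := by
      intro j hj hjp
      obtain ⟨l, -, hml, -, hil, -⟩ := exists_others m i hi.symm
      exact hgood _ hs (hx m hi.symm) j hj hjp l hml.symm (hx l hil.symm)
    rcases hz k with ⟨l, rfl⟩ | ⟨j, hj, rfl⟩ | rfl
    · rw [hX.dual] at hk
      split_ifs at hk <;> linarith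
    · exact absurd hkz (hy j hj)
    · refine ⟨hk, fun j hj => ?_⟩
      have h1 := lt_of_le_of_ne (hmem (y j)) (hy j hj).symm
      rw [eval_add, eval_smul] at h1 hkz
      have h2 := mul_pos (sub_pos.2 h1) (neg_pos.2 hk)
      have h3 : P.eval k u - P.rhs k = α * -P.eval k (e i) := by linarith
      rw [h3]
      linarith
  have hmix : ∀ i k, i ≠ m → k ≠ m → P.eval z (e i) < 0 → 0 < P.eval z (e k) → ∀ j,
      0 ≤ P.eval z (e k) * P.eval (y j) (e i) + -P.eval z (e i) * P.eval (y j) (e k) := by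
    intro i k hi hk hzi hzk
    have hik : i ≠ k := by
      rintro rfl
      linarith
    have heg : ∀ r, P.eval r (P.eval z (e k) • e i + -P.eval z (e i) • e k)
        = P.eval z (e k) * P.eval r (e i) + -P.eval z (e i) * P.eval r (e k) :=
      fun r => by simp only [eval_add, eval_smul]
    by_contra! hneg
    obtain ⟨j₀, hj₀⟩ := hneg
    obtain ⟨α, hα, hmem, r, hr, hrz⟩ := P.exists_blocking hX.mem ⟨y j₀, by rwa [heg]⟩
    have hs : P.WeakStep u (u + α • (P.eval z (e k) • e i + -P.eval z (e i) • e k)) :=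
      ⟨hmem, _, hX.isCircuit hik z (Or.inl hzk.ne') (Or.inl hzi.ne) (by ring), α, hα, rfl, r, hr, hrz⟩
    have hx : ∀ l, l ≠ i → l ≠ k →
        P.eval (x l) (u + α • (P.eval z (e k) • e i + -P.eval z (e i) • e k)) = P.rhs (x l) := by
      intro l hli hlk
      rw [eval_add, eval_smul, heg, hX.act, hX.dual_ne hli, hX.dual_ne hlk]
      ring
    rw [heg] at hr
    rcases hz r with ⟨l, rfl⟩ | ⟨j, hj, rfl⟩ | rfl
    · simp only [hX.dual] at hr
      split_ifs at hr <;> linarith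
    · obtain ⟨l, hlm, hli, hlk, -⟩ := exists_fourth m i k hi.symm hk hik.symm
      exact hgood _ hs (hx m hi.symm hk.symm) j hj hrz l hlm (hx l hli hlk)
    · linarith
  obtain ⟨j, hj⟩ := exists_ne n
  have := slack_pos (S := (· ≠ m)) (Y₀ := P.eval (y j) u - P.rhs (y j)) (z₀ := P.eval z u - P.rhs z)
    (w := fun i => P.eval (x i) v - P.rhs (x i)) (η := fun i => P.eval (y j) (e i))
    (ζ := fun i => P.eval z (e i)) (sub_pos.2 (hyu j hj)) (fun i => sub_nonneg.2 (hY.mem _))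
    (fun i hi => by rw [not_not.1 hi, hmn, hY.act, sub_self])
    (fun i hi hzi => (hdir i hi).elim (fun h => absurd (h z) hzi.not_ge) fun h => h.2 j hj)
    (fun i hi hzi => (hdir i hi).elim (fun h => h _) fun h => absurd h.1 hzi.not_gt)
    (fun i k hi hk hzi hzk => hmix i k hi hk hzi hzk j)
    (by have h1 := hX.eval_pt z v
        have h2 := hY.mem z
        linarith)
  have h1 := hX.eval_pt (y j) v
  rw [hY.act] at h1
  linarith

theorem IsVertex.reach_four {P : PolyData 4 8} (hP : P.IsProper) {u v : Fin 4 → ℝ}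
    (hu : P.IsVertex u) (hv : P.IsVertex v) : P.Reach 4 u v := by
  have hrow : ∀ k, k ∈ P.activeAt v → P.row k ≠ 0 := by
    intro k hk h0
    obtain ⟨⟨w, hw⟩, -⟩ := hP
    have h1 : ∀ z, P.eval k z = 0 := fun z => by simp [eval, h0]
    have h2 := hw k
    rw [h1, ← show P.eval k v = P.rhs k from hk, h1] at h2
    exact h2.false
  by_cases h2 : ∃ c₀ c₁, c₀ ≠ c₁ ∧ ({c₀, c₁} : Set (Fin 8)) ⊆ P.activeAt u ∩ P.activeAt v ∧
      LinearIndepOn ℝ P.row {c₀, c₁}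
  · obtain ⟨c₀, c₁, hc, hsub, hli⟩ := h2
    obtain ⟨y, δ, hY, hy⟩ := hv.exists_frame (hsub.trans Set.inter_subset_right) hli
    obtain ⟨m, rfl⟩ := hy c₀ (by simp)
    obtain ⟨n, rfl⟩ := hy c₁ (by simp)
    have hmn : m ≠ n := fun h => hc (by rw [h])
    obtain ⟨a, b, -, -, -, -, hab, hall⟩ := exists_others m n hmn
    by_cases hl : ∃ l, P.eval l u = P.rhs l ∧ P.rhs l < P.eval l v
    · obtain ⟨l, hlu, hlv⟩ := hl
      refine (hY.reach_three hab hu.1 (fun k hka hkb => ?_) hlu hlv).succ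
      rcases hall k with rfl | rfl | rfl | rfl
      · exact (hsub (by simp : y k ∈ _)).1
      · exact (hsub (by simp : y k ∈ _)).1
      · exact absurd rfl hka
      · exact absurd rfl hkb
    · push Not at hl
      obtain ⟨x, e, hX, -⟩ := hu.exists_frame (Set.empty_subset _) (linearIndepOn_empty ℝ _)
      have : u = v := sub_eq_zero.1 <| hX.inj _ fun i => by
        rw [eval_sub, hX.act, sub_eq_zero]
        exact le_antisymm (hv.1 _) (hl _ (hX.act i))
      rw [this]
      exact Reach.refl _ _ _
  by_cases h1 : ∃ c₀, c₀ ∈ P.activeAt u ∧ c₀ ∈ P.activeAt v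
  · obtain ⟨c₀, hcu, hcv⟩ := h1
    have hli : LinearIndepOn ℝ P.row {c₀} := LinearIndepOn.singleton (hrow c₀ hcv)
    obtain ⟨x, e, hX, hx⟩ := hu.exists_frame (Set.singleton_subset_iff.2 hcu) hli
    obtain ⟨y, δ, hY, hy⟩ := hv.exists_frame (Set.singleton_subset_iff.2 hcv) hli
    obtain ⟨m, hm⟩ := hx c₀ rfl
    obtain ⟨n, hn⟩ := hy c₀ rfl
    refine hX.reach_four_of_common_facet hY (hm.trans hn.symm) (fun i hi => ?_) fun j hj => ?_
    · refine lt_of_le_of_ne (hv.1 _) fun h => h2 ⟨x m, x i, ?_, ?_, ?_⟩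
      · exact hX.injective.ne hi.symm
      · rintro k (rfl | rfl)
        · exact ⟨hX.act m, by rwa [hm]⟩
        · exact ⟨hX.act i, h.symm⟩
      · exact hX.linearIndepOn_pair hi.symm
    · refine lt_of_le_of_ne (hu.1 _) fun h => h2 ⟨y n, y j, ?_, ?_, ?_⟩
      · exact hY.injective.ne hj.symm
      · rintro k (rfl | rfl)
        · exact ⟨by rwa [hn], hY.act n⟩
        · exact ⟨h.symm, hY.act j⟩
      · exact hY.linearIndepOn_pair hj.symm
  · push Not at h1
    obtain ⟨x, e, hX, -⟩ := hu.exists_frame (Set.empty_subset _) (linearIndepOn_empty ℝ _)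
    obtain ⟨y, δ, hY, -⟩ := hv.exists_frame (Set.empty_subset _) (linearIndepOn_empty ℝ _)
    have hxv : ∀ i, P.rhs (x i) < P.eval (x i) v := fun i =>
      lt_of_le_of_ne (hv.1 _) fun h => h1 _ (hX.act i) h.symm
    have hyu : ∀ j, P.rhs (y j) < P.eval (y j) u := fun j =>
      lt_of_le_of_ne (hu.1 _) fun h => h1 _ h.symm (hY.act j)
    refine Opposite.reach_four ⟨hX, hY, hxv, hyu, fun k => ?_⟩
    have hcard : (Finset.univ.image x ∪ Finset.univ.image y).card = Fintype.card (Fin 8) := by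
      rw [Finset.card_union_of_disjoint, Finset.card_image_of_injective _ hX.injective,
        Finset.card_image_of_injective _ hY.injective, Finset.card_univ, Fintype.card_fin,
        Fintype.card_fin]
      rw [Finset.disjoint_left]
      intro k hkx hky
      obtain ⟨i, -, rfl⟩ := Finset.mem_image.1 hkx
      obtain ⟨j, -, hji⟩ := Finset.mem_image.1 hky
      exact h1 _ (hX.act i) (hji ▸ hY.act j)
    have hk : k ∈ Finset.univ.image x ∪ Finset.univ.image y := by
      rw [(Finset.card_eq_iff_eq_univ _).1 hcard]
      exact Finset.mem_univ k
    simpa [eq_comm] using hk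

/-- The unit cube `[0,1]^d`. -/
def cube (d : ℕ) : PolyData d (d + d) where
  A i j := Fin.addCases (fun i => if i = j then 1 else 0) (fun i => if i = j then -1 else 0) i
  b i := Fin.addCases (fun _ => 0) (fun _ => -1) i

namespace cube

theorem row_castAdd (j : Fin d) : (cube d).row (Fin.castAdd d j) = Pi.single j 1 := by
  ext i
  simp [row, cube, Pi.single_apply, apply_ite (Rat.cast : ℚ → ℝ), eq_comm]

theorem row_natAdd (j : Fin d) : (cube d).row (Fin.natAdd d j) = Pi.single j (-1) := by
  ext i
  simp [row, cube, Pi.single_apply, apply_ite (Rat.cast : ℚ → ℝ), eq_comm,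
    -Fin.natAdd_eq_addNat]

theorem eval_castAdd (j : Fin d) (z : Fin d → ℝ) : (cube d).eval (Fin.castAdd d j) z = z j := by
  simp [eval, row_castAdd, Pi.single_apply]

theorem eval_natAdd (j : Fin d) (z : Fin d → ℝ) : (cube d).eval (Fin.natAdd d j) z = -z j := by
  simp [eval, row_natAdd, Pi.single_apply, -Fin.natAdd_eq_addNat]

theorem rhs_castAdd (j : Fin d) : (cube d).rhs (Fin.castAdd d j) = 0 := by
  simp [rhs, cube]

theorem rhs_natAdd (j : Fin d) : (cube d).rhs (Fin.natAdd d j) = -1 := by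
  simp [rhs, cube, -Fin.natAdd_eq_addNat]

theorem forall_iff {p : Fin (d + d) → Prop} :
    (∀ i, p i) ↔ (∀ j, p (Fin.castAdd d j)) ∧ ∀ j, p (Fin.natAdd d j) :=
  ⟨fun h => ⟨fun _ => h _, fun _ => h _⟩, fun h => Fin.addCases h.1 h.2⟩

theorem mem_toSet {z : Fin d → ℝ} : z ∈ (cube d).toSet ↔ (∀ j, 0 ≤ z j) ∧ ∀ j, z j ≤ 1 := by
  change (∀ i, _) ↔ _
  rw [forall_iff]
  simp [eval_castAdd, eval_natAdd, rhs_castAdd, rhs_natAdd, -Fin.natAdd_eq_addNat]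

theorem isProper : (cube d).IsProper := by
  refine ⟨⟨fun _ => 1 / 2, forall_iff.2 ⟨fun j => ?_, fun j => ?_⟩⟩,
    forall_iff.2 ⟨fun j => ?_, fun j => ?_⟩⟩
  · rw [eval_castAdd, rhs_castAdd]
    norm_num
  · rw [eval_natAdd, rhs_natAdd]
    norm_num
  · refine ⟨fun k => if k = j then 0 else 1 / 2, mem_toSet.2 ⟨fun k => ?_, fun k => ?_⟩, ?_,
      forall_iff.2 ⟨fun k hk => ?_, fun k hk => ?_⟩⟩
    · split_ifs <;> norm_num
    · split_ifs <;> norm_num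
    · rw [eval_castAdd, rhs_castAdd, if_pos rfl]
    · rw [eval_castAdd, rhs_castAdd, if_neg fun h => hk (by rw [h])]
      norm_num
    · rw [eval_natAdd, rhs_natAdd]
      split_ifs <;> norm_num
  · refine ⟨fun k => if k = j then 1 else 1 / 2, mem_toSet.2 ⟨fun k => ?_, fun k => ?_⟩, ?_,
      forall_iff.2 ⟨fun k hk => ?_, fun k hk => ?_⟩⟩
    · split_ifs <;> norm_num
    · split_ifs <;> norm_num
    · rw [eval_natAdd, rhs_natAdd, if_pos rfl]
    · rw [eval_castAdd, rhs_castAdd]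
      split_ifs <;> norm_num
    · rw [eval_natAdd, rhs_natAdd, if_neg fun h => hk (by rw [h])]
      norm_num

theorem isVertex_of_rows {v : Fin d → ℝ} (hv : v ∈ (cube d).toSet) (c : ℝ) (hc : c ≠ 0)
    (h : ∀ j, ∃ k ∈ (cube d).activeAt v, (cube d).row k = Pi.single j c) :
    (cube d).IsVertex v := by
  refine ⟨hv, eq_top_iff.2 fun w _ => ?_⟩
  have hw : w = ∑ j, (w j / c) • (Pi.single j c : Fin d → ℝ) := by
    ext i
    simp [Finset.sum_apply, Pi.single_apply, hc]
  rw [hw]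
  refine Submodule.sum_mem _ fun j _ => Submodule.smul_mem _ _ (Submodule.subset_span ?_)
  obtain ⟨k, hk, hkj⟩ := h j
  exact ⟨k, hk, hkj⟩

theorem isVertex_zero : (cube d).IsVertex 0 := by
  refine isVertex_of_rows (mem_toSet.2 (by simp)) 1 one_ne_zero fun j =>
    ⟨Fin.castAdd d j, ?_, row_castAdd j⟩
  · change _ = _
    rw [eval_castAdd, rhs_castAdd, Pi.zero_apply]

theorem isVertex_one : (cube d).IsVertex 1 := by
  refine isVertex_of_rows (mem_toSet.2 (by simp)) (-1) (by norm_num)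
    fun j => ⟨Fin.natAdd d j, ?_, row_natAdd j⟩
  · change _ = _
    rw [eval_natAdd, rhs_natAdd, Pi.one_apply]

/-- Circuits of the cube are parallel to the axes. -/
theorem exists_axis {g : Fin d → ℝ} (hg : (cube d).IsCircuit g) : ∃ i, ∀ j, j ≠ i → g j = 0 := by
  obtain ⟨i, hi⟩ : ∃ i, g i ≠ 0 := by
    by_contra! hcon
    exact hg.1 (funext hcon)
  have hsupp := hg.2 (Pi.single i 1) (by simp) (forall_iff.2
    ⟨fun j hj => by
      have : j = i := by
        by_contra hne
        simp [eval_castAdd, hne] at hj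
      simpa [eval_castAdd, this] using hi, fun j hj => by
      have : j = i := by
        by_contra hne
        simp [eval_natAdd, hne, -Fin.natAdd_eq_addNat] at hj
      simpa [eval_natAdd, this, -Fin.natAdd_eq_addNat] using hi⟩)
  refine ⟨i, fun j hj => ?_⟩
  by_contra hne
  have : Fin.castAdd d j ∈ {k | (cube d).eval k g ≠ 0} := by simpa [eval_castAdd] using hne
  rw [← hsupp] at this
  simp [eval_castAdd, hj] at this

theorem card_support_le {k : ℕ} {y : Fin (k + 1) → Fin d → ℝ} (hy : (cube d).IsCircuitWalk y)
    (h0 : y 0 = 0) (i : Fin (k + 1)) : (Finset.univ.filter fun j => y i j ≠ 0).card ≤ i := by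
  induction i using Fin.induction with
  | zero => simp [h0]
  | succ i ih =>
    obtain ⟨g, hg, α, -, hstep, -⟩ := hy.2 i
    obtain ⟨m, hm⟩ := exists_axis hg
    refine (Finset.card_le_card (t := insert m (Finset.univ.filter fun j => y i.castSucc j ≠ 0))
      fun j hj => ?_).trans ((Finset.card_insert_le _ _).trans ?_)
    · rw [Finset.mem_insert]
      by_contra! hcon
      simp only [Finset.mem_filter, Finset.mem_univ, true_and, not_not] at hj hcon
      exact hj (by rw [hstep, Pi.add_apply, hcon.2, Pi.smul_apply, hm j hcon.1, smul_zero,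
        add_zero])
    · simpa using ih

theorem le_circuitDistance : (d : ℕ∞) ≤ (cube d).circuitDistance 0 1 := by
  refine le_sInf ?_
  rintro _ ⟨k, rfl, y, hy, h0, h1⟩
  have := card_support_le hy h0 (Fin.last k)
  simp only [h1, Pi.one_apply, ne_eq, one_ne_zero, not_false_eq_true, Finset.filter_true,
    Finset.card_univ, Fintype.card_fin, Fin.val_last] at this
  exact_mod_cast this

end cube

theorem circuitDiameter_le {P : PolyData 4 8} (hP : P.IsProper) : P.circuitDiameter ≤ 4 :=
  iSup₂_le fun _ _ => iSup₂_le fun hu hv => (hu.reach_four hP hv).circuitDistance_le hu.1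

end PolyData

/-- Theorem 4, circuit 4-step conjecture:
`Δ_C(8,4) = 4`. -/
theorem circuit_four_step : maxCircuitDiameter 8 4 = 4 := by
  refine le_antisymm (iSup₂_le fun P hP => PolyData.circuitDiameter_le hP) ?_
  have h1 : (4 : ℕ∞) ≤ (PolyData.cube 4).circuitDiameter :=
    PolyData.cube.le_circuitDistance.trans <| le_iSup₂_of_le 0 1 <|
      le_iSup₂_of_le PolyData.cube.isVertex_zero PolyData.cube.isVertex_one le_rfl
  exact h1.trans (le_iSup₂_of_le (f := fun (P : PolyData 4 8) (_ : P.IsProper) => P.circuitDiameter)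
    (PolyData.cube 4) PolyData.cube.isProper le_rfl)
end

section
/- Let P(u,v) = P(u) ∩ P(v) ⊂ ℝ^4 be an unbounded spindle arising as the intersection of the two cones P(u) and P(v) of the facets incident to the vertices u and v, respectively, and suppose the cone P(v) is simple (exactly 4 facets are incident to v). Then there is a circuit walk of length at most 4 from u to v. -/
open scoped BigOperators

namespace SpindleWalk

/-- Moving from nonnegative slacks `s` at rates `r`, some slack is the first to vanish. -/
lemma exists_first_hit {κ : Type*} [Finite κ] (s r : κ → ℝ) (hs : ∀ i, 0 ≤ s i)
    (hr : ∀ i, r i < 0 → 0 < s i) (hne : ∃ i, r i < 0) :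
    ∃ t : ℝ, 0 < t ∧ (∀ i, 0 ≤ s i + t * r i) ∧ ∃ i, r i < 0 ∧ s i + t * r i = 0 := by
  obtain ⟨i₀, hi₀, hmin⟩ :=
    Set.exists_min_image {i | r i < 0} (fun i => s i / (-r i)) (Set.toFinite _) hne
  simp only [Set.mem_ofPred_eq] at hi₀ hmin
  refine ⟨s i₀ / (-r i₀), div_pos (hr _ hi₀) (by linarith), fun i => ?_, i₀, hi₀, ?_⟩
  · rcases lt_or_ge (r i) 0 with hi | hi
    · have h := hmin i hi
      rw [le_div_iff₀ (by linarith)] at h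
      linarith
    · have : 0 ≤ s i₀ / (-r i₀) := (div_pos (hr _ hi₀) (by linarith)).le
      have := mul_nonneg this hi
      linarith [hs i]
  · have : r i₀ ≠ 0 := hi₀.ne
    field_simp
    ring

/-- A pointed polyhedral cone containing a vector on which `φ` is negative
has an extreme ray on which `φ` is negative. -/
lemma exists_extreme_ray {V κ κ' : Type*} [AddCommGroup V] [Module ℝ V] [Finite κ]
    (f : κ → V →ₗ[ℝ] ℝ) (g : κ' → V →ₗ[ℝ] ℝ) (φ : V →ₗ[ℝ] ℝ)
    (hpt : ∀ x, (∀ i, f i x = 0) → (∀ j, g j x = 0) → x = 0)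
    (h : ∃ d, (∀ i, f i d ≤ 0) ∧ (∀ j, g j d = 0) ∧ φ d < 0) :
    ∃ d, (∀ i, f i d ≤ 0) ∧ (∀ j, g j d = 0) ∧ φ d < 0 ∧
      ∀ x, (∀ i, f i d = 0 → f i x = 0) → (∀ j, g j x = 0) → ∃ t : ℝ, x = t • d := by
  set D : Set V := {d | (∀ i, f i d ≤ 0) ∧ (∀ j, g j d = 0) ∧ φ d < 0} with hD
  let Z : V → Set κ := fun d => {i | f i d = 0}
  obtain ⟨_, ⟨d, hd, rfl⟩, hmax⟩ :=
    (Set.toFinite (Z '' D)).exists_maximal (Set.Nonempty.image Z h)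
  refine ⟨d, hd.1, hd.2.1, hd.2.2, fun x hx hxg => ?_⟩
  by_contra hcon
  obtain ⟨hd1, hd2, hd3⟩ := hd
  have key : ∀ e : V, (∀ i, f i d = 0 → f i e = 0) → (∀ j, g j e = 0) → φ e = 0 →
      ¬ ∃ i, 0 < f i e := by
    rintro e he heg heφ ⟨i, hi⟩
    obtain ⟨t, ht, hall, i₀, hi₀, hi₀'⟩ := exists_first_hit (fun i => - f i d) (fun i => - f i e)
      (fun i => by linarith [hd1 i])
      (fun i hi => by
        rcases (hd1 i).lt_or_eq with h' | h'
        · simpa using h'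
        · have := he i h'
          simp [this] at hi)
      ⟨i, by simpa using hi⟩
    have hmem : d + t • e ∈ D := by
      refine ⟨fun i => ?_, fun j => ?_, ?_⟩
      · have := hall i
        simp only [map_add, map_smul, smul_eq_mul]
        linarith
      · simp [hd2 j, heg j]
      · simpa [heφ] using hd3
    have hsub : Z d ⊆ Z (d + t • e) := by
      intro i hi
      have hi' : f i d = 0 := hi
      simp [Z, hi', he i hi']
    have hback := hmax (Set.mem_image_of_mem Z hmem) hsub
    have hi₀Z : i₀ ∈ Z (d + t • e) := by
      simp only [Z, Set.mem_ofPred_eq, map_add, map_smul, smul_eq_mul]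
      linarith
    have h0 := he i₀ (hback hi₀Z)
    simp [h0] at hi₀
  set e : V := x - (φ x / φ d) • d with he
  have he1 : ∀ i, f i d = 0 → f i e = 0 := fun i hi => by simp [he, hi, hx i hi]
  have he2 : ∀ j, g j e = 0 := fun j => by simp [he, hd2 j, hxg j]
  have he3 : φ e = 0 := by
    have : φ d ≠ 0 := hd3.ne
    simp [he]
    field_simp
    simp
  have k1 := key e he1 he2 he3
  have k2 := key (-e) (fun i hi => by simp [he1 i hi]) (fun j => by simp [he2 j]) (by simp [he3])
  push Not at k1 k2
  have he0 : e = 0 := hpt e (fun i => le_antisymm (k1 i) (by simpa using k2 i)) he2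
  exact hcon ⟨φ x / φ d, sub_eq_zero.mp he0⟩

section Orthant

variable {ι : Type*} (c : ι → (Fin 4 → ℝ) →ₗ[ℝ] ℝ) (u : Fin 4 → ℝ)

/-- The part of the orthant cut out by constraints `c i` that are all tight at `u`. -/
def Feas (x : Fin 4 → ℝ) : Prop := (∀ k, 0 ≤ x k) ∧ ∀ i, c i x ≤ c i u

/-- The forms `c i` vanishing on `g` determine `g` up to scaling. -/
def Ray (g : Fin 4 → ℝ) : Prop :=
  ∀ z : Fin 4 → ℝ, (∀ i, c i g = 0 → c i z = 0) → ∃ t : ℝ, z = t • g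

/-- Either no move, or a move along a ray into a new coordinate hyperplane. -/
def Step (x y : Fin 4 → ℝ) : Prop :=
  x = y ∨ (Ray c (y - x) ∧ ∃ k, 0 < x k ∧ y k = 0)

/-- The linear form `x₁ + x₂ + x₃ - ρ x₀`. -/
noncomputable def ratioForm (ρ : ℝ) : (Fin 4 → ℝ) →ₗ[ℝ] ℝ :=
  let π : Fin 4 → (Fin 4 → ℝ) →ₗ[ℝ] ℝ := fun k => LinearMap.proj k
  π 1 + π 2 + π 3 - ρ • π 0

lemma ratioForm_apply (ρ : ℝ) (x : Fin 4 → ℝ) :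
    ratioForm ρ x = x 1 + x 2 + x 3 - ρ * x 0 := by
  simp [ratioForm]

/-- The points of the facet `i₀` one ray away from `u`, with positive zeroth coordinate. -/
def firstPoints (i₀ : ι) : Set (Fin 4 → ℝ) :=
  {y | Feas c u y ∧ c i₀ y = c i₀ u ∧ 0 < y 0 ∧ (∃ j, y j = 0) ∧
    ∀ z, (∀ i, c i y = c i u → c i z = 0) → ∃ t : ℝ, z = t • (y - u)}

variable {c u}

lemma finite_firstPoints [Finite ι] (hu : ∀ k, 0 < u k) (i₀ : ι) :
    (firstPoints c u i₀).Finite := by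
  let F : (Fin 4 → ℝ) → Set ι × Set (Fin 4) := fun y => ({i | c i y = c i u}, {j | y j = 0})
  refine Set.Finite.of_finite_image (f := F) (Set.toFinite _) ?_
  rintro y ⟨-, -, -, ⟨j, hj⟩, hy⟩ y' - hyy
  have h1 : {i | c i y = c i u} = {i | c i y' = c i u} := congrArg Prod.fst hyy
  have h2 : {j | y j = 0} = {j | y' j = 0} := congrArg Prod.snd hyy
  have hj' : y' j = 0 := (Set.ext_iff.mp h2 j).mp hj
  obtain ⟨t, ht⟩ := hy (y' - u) (fun i hi => by
    have : c i y' = c i u := (Set.ext_iff.mp h1 i).mp hi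
    simp [this])
  have := congrFun ht j
  simp only [Pi.sub_apply, Pi.smul_apply, smul_eq_mul, hj, hj'] at this
  have ht1 : t = 1 := by
    have := hu j
    nlinarith
  rw [ht1, one_smul] at ht
  exact (sub_left_inj.mp ht).symm

lemma pos_of_ratioForm_neg {ρ : ℝ} {x : Fin 4 → ℝ} (hx : ∀ k, 0 ≤ x k)
    (h : ratioForm ρ x < 0) : 0 < x 0 := by
  rw [ratioForm_apply] at h
  by_contra h0
  have : x 0 = 0 := le_antisymm (not_lt.mp h0) (hx 0)
  rw [this] at h
  linarith [hx 1, hx 2, hx 3]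

lemma firstPoints_nonempty [Finite ι] (hbox : ∀ k, ∃ i, c i = LinearMap.proj k)
    (hu : ∀ k, 0 < u k) (i₀ : ι) {p : Fin 4 → ℝ} (hp : Feas c u p)
    (hp₀ : c i₀ p = c i₀ u) (hppos : 0 < p 0) (hpz : ∀ k, k ≠ 0 → p k = 0) :
    (firstPoints c u i₀).Nonempty := by
  set ρ := (u 1 + u 2 + u 3) / u 0 with hρ
  have hu0 := hu 0
  have hρpos : 0 < ρ := div_pos (by linarith [hu 1, hu 2, hu 3]) hu0
  have hφu : ratioForm ρ u = 0 := by
    rw [ratioForm_apply, hρ]; field_simp; ring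
  obtain ⟨d, hd, hg, hφ, hext⟩ := exists_extreme_ray c (fun _ : Unit => c i₀) (ratioForm ρ)
    (fun x hx _ => by
      ext k
      obtain ⟨i, hi⟩ := hbox k
      have := hx i
      rwa [hi] at this)
    ⟨p - u, fun i => by simpa using hp.2 i, fun _ => by simp [hp₀], by
      rw [map_sub, hφu, ratioForm_apply, hpz 1 (by decide), hpz 2 (by decide), hpz 3 (by decide)]
      nlinarith⟩
  have hdk : ∀ k, d k ≤ 0 := fun k => by
    obtain ⟨i, hi⟩ := hbox k
    have := hd i
    rwa [hi] at this
  have hne : ∃ k, d k < 0 := by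
    by_contra hcon
    push Not at hcon
    have : d = 0 := funext fun k => le_antisymm (hdk k) (hcon k)
    simp [this] at hφ
  obtain ⟨t, ht, hall, j, -, hj⟩ := exists_first_hit u d (fun k => (hu k).le) (fun k _ => hu k) hne
  have hfeas : ∀ k, 0 ≤ (u + t • d) k := fun k => by simpa using hall k
  refine ⟨u + t • d, ⟨hfeas, fun i => ?_⟩, ?_, ?_, ⟨j, by simpa using hj⟩, fun z hz => ?_⟩
  · have := mul_nonpos_of_nonneg_of_nonpos ht.le (hd i)
    simpa using this
  · simp [hg ()]
  · refine pos_of_ratioForm_neg (ρ := ρ) hfeas ?_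
    rw [map_add, map_smul, hφu, smul_eq_mul]
    nlinarith
  · obtain ⟨s, rfl⟩ := hext z (fun i hi => hz i (by simp [hi])) (fun _ => hz i₀ (by simp [hg ()]))
    refine ⟨s / t, ?_⟩
    rw [add_sub_cancel_left, smul_smul, div_mul_cancel₀ _ ht.ne']

/-- From a first point of least ratio with a single vanishing coordinate, a further
coordinate can be made to vanish within the facet `i₀`. -/
lemma exists_second_point [Finite ι] (hbox : ∀ k, ∃ i, c i = LinearMap.proj k)
    (hu : ∀ k, 0 < u k) (i₀ : ι) {p : Fin 4 → ℝ} (hp : Feas c u p)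
    (hp₀ : c i₀ p = c i₀ u) (hppos : 0 < p 0) (hpz : ∀ k, k ≠ 0 → p k = 0)
    {y : Fin 4 → ℝ} (hy : y ∈ firstPoints c u i₀)
    (hmin : ∀ y' ∈ firstPoints c u i₀,
      (y 1 + y 2 + y 3) / y 0 ≤ (y' 1 + y' 2 + y' 3) / y' 0)
    {j : Fin 4} (hj : y j = 0) (hjpos : ∀ k, k ≠ j → 0 < y k) :
    ∃ y₂, Feas c u y₂ ∧ c i₀ y₂ = c i₀ u ∧ 0 < y₂ 0 ∧ y₂ j = 0 ∧ (∃ k, k ≠ j ∧ y₂ k = 0) ∧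
      Step c y y₂ := by
  obtain ⟨⟨hy0, hyc⟩, hyi₀, hypos, -, hray⟩ := hy
  have hj0 : j ≠ 0 := by rintro rfl; linarith
  set ρ := (y 1 + y 2 + y 3) / y 0 with hρ
  have hsum : 0 < y 1 + y 2 + y 3 := by
    rcases eq_or_ne j 1 with rfl | h1
    · linarith [hy0 1, hjpos 2 (by decide), hy0 3]
    · linarith [hy0 2, hjpos 1 h1.symm, hy0 3]
  have hρpos : 0 < ρ := div_pos hsum hypos
  have hφy : ratioForm ρ y = 0 := by
    rw [ratioForm_apply, hρ]; field_simp; ring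
  obtain ⟨d, hd, hg, hφ, hext⟩ := exists_extreme_ray
    (fun i : {i // c i y = c i u} => c i.1)
    (fun b : Bool => if b then c i₀ else LinearMap.proj j) (ratioForm ρ)
    (fun x hx hx' => by
      obtain ⟨t, rfl⟩ := hray x (fun i hi => hx ⟨i, hi⟩)
      have := hx' false
      simp only [Bool.false_eq_true, if_false, LinearMap.proj_apply, Pi.smul_apply, Pi.sub_apply,
        hj, smul_eq_mul] at this
      have ht : t = 0 := by
        have := hu j
        rcases mul_eq_zero.mp ‹t * (0 - u j) = 0› with h | h
        · exact h
        · linarith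
      simp [ht])
    ⟨p - y, fun i => by simpa [i.2] using hp.2 i.1, fun b => by
      cases b
      · simp [hj, hpz j hj0]
      · simp [hp₀, hyi₀], by
      rw [map_sub, hφy, ratioForm_apply, hpz 1 (by decide), hpz 2 (by decide), hpz 3 (by decide)]
      nlinarith⟩
  have hgi : c i₀ d = 0 := by simpa using hg true
  have hgj : d j = 0 := by simpa using hg false
  have hne : ∃ a : Fin 4 ⊕ ι, Sum.elim d (fun i => - c i d) a < 0 := by
    by_contra hcon
    push Not at hcon
    have : d = 0 := funext fun k => by
      obtain ⟨i, hi⟩ := hbox k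
      have h1 := hcon (Sum.inl k)
      have h2 := hcon (Sum.inr i)
      simp only [Sum.elim_inl, Sum.elim_inr, hi, LinearMap.proj_apply] at h1 h2
      simp only [Pi.zero_apply]
      linarith
    simp [this] at hφ
  obtain ⟨t, ht, hall, a, ha, ha0⟩ := exists_first_hit
    (Sum.elim y (fun i => c i u - c i y)) (Sum.elim d (fun i => - c i d))
    (by rintro (k | i)
        · exact hy0 k
        · simpa using hyc i)
    (by rintro (k | i) h
        · refine hjpos k ?_
          rintro rfl
          simp [hgj] at h
        · rcases (hyc i).lt_or_eq with h' | h'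
          · simpa using h'
          · have := hd ⟨i, h'⟩
            simp only [Sum.elim_inr] at h
            linarith) hne
  have hfeas0 : ∀ k, 0 ≤ (y + t • d) k := fun k => by simpa using hall (Sum.inl k)
  have hfeas : Feas c u (y + t • d) := ⟨hfeas0, fun i => by
    have := hall (Sum.inr i)
    simp only [Sum.elim_inr, map_add, map_smul, smul_eq_mul] at this ⊢
    linarith⟩
  have hφ2 : ratioForm ρ (y + t • d) < 0 := by
    rw [map_add, map_smul, hφy, smul_eq_mul]
    nlinarith
  have hpos2 := pos_of_ratioForm_neg hfeas0 hφ2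
  have hi2 : c i₀ (y + t • d) = c i₀ u := by simp [hgi, hyi₀]
  have hj2 : (y + t • d) j = 0 := by simp [hgj, hj]
  rcases a with k | i₁
  · simp only [Sum.elim_inl] at ha ha0
    have hkj : k ≠ j := by rintro rfl; linarith
    have hk2 : (y + t • d) k = 0 := by simpa using ha0
    refine ⟨y + t • d, hfeas, hi2, hpos2, hj2, ⟨k, hkj, hk2⟩, Or.inr ⟨fun z hz => ?_, k,
      hjpos k hkj, hk2⟩⟩
    rw [add_sub_cancel_left] at hz ⊢
    obtain ⟨i, hi⟩ := hbox j
    obtain ⟨s, rfl⟩ := hext z (fun i hi => hz i (by simp [hi])) (fun b => by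
      cases b
      · have := hz i (by simp [hi, hgj])
        simpa [hi] using this
      · have := hz i₀ (by simp [hgi])
        simpa using this)
    refine ⟨s / t, ?_⟩
    rw [smul_smul, div_mul_cancel₀ _ ht.ne']
  · exfalso
    simp only [Sum.elim_inr] at ha ha0
    have hmem : y + t • d ∈ firstPoints c u i₀ := by
      refine ⟨hfeas, hi2, hpos2, ⟨j, hj2⟩, fun z hz => ?_⟩
      have huj := hu j
      refine ⟨- z j / u j, ?_⟩
      set w : Fin 4 → ℝ := z - (- z j / u j) • (y + t • d - u) with hw
      have hwc : ∀ i, c i (y + t • d) = c i u → c i w = 0 := fun i hi => by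
        rw [hw, map_sub, hz i hi, map_smul, map_sub, hi]
        simp
      obtain ⟨s, hs⟩ := hext w
        (fun i hi => hwc i.1 (by
          rw [map_add, map_smul, hi, i.2]
          simp))
        (fun b => by
          cases b
          · simp only [Bool.false_eq_true, if_false, LinearMap.proj_apply, hw, Pi.sub_apply,
              Pi.smul_apply, hj2, smul_eq_mul]
            field_simp
            ring
          · simpa using hwc i₀ hi2)
      have h1 := hwc i₁ (by
        simp only [map_add, map_smul, smul_eq_mul]
        linarith)
      rw [hs, map_smul, smul_eq_mul] at h1
      have hs0 : s = 0 := by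
        rcases mul_eq_zero.mp h1 with h | h
        · exact h
        · linarith
      rw [hs0, zero_smul] at hs
      exact sub_eq_zero.mp hs
    have h1 := hmin _ hmem
    rw [le_div_iff₀ hpos2] at h1
    rw [ratioForm_apply] at hφ2
    linarith

/-- Moving within a coordinate plane to the axis, inside the facet `i₀`. -/
lemma step_to_axis (hbox : ∀ k, ∃ i, c i = LinearMap.proj k) (i₀ : ι) {p y : Fin 4 → ℝ}
    (hp₀ : c i₀ p = c i₀ u) (hppos : 0 < p 0) (hpz : ∀ k, k ≠ 0 → p k = 0) (hcu : 0 < c i₀ u)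
    (hy : Feas c u y) (hy₀ : c i₀ y = c i₀ u) (hypos : 0 < y 0) {j k : Fin 4} (hjk : k ≠ j)
    (hj : y j = 0) (hk : y k = 0) : Step c y p := by
  have hj0 : j ≠ 0 := by rintro rfl; linarith
  have hk0 : k ≠ 0 := by rintro rfl; linarith
  obtain ⟨l, hl0, hlj, hlk, hall⟩ : ∃ l : Fin 4, l ≠ 0 ∧ l ≠ j ∧ l ≠ k ∧
      ∀ i, i = 0 ∨ i = j ∨ i = k ∨ i = l := by
    clear hj hk
    revert j k
    decide
  have axis : ∀ x : Fin 4 → ℝ, (∀ i, i ≠ 0 → x i = 0) → x = (x 0 / p 0) • p := fun x hx => by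
    ext i
    rcases eq_or_ne i 0 with rfl | hi
    · simp [hppos.ne']
    · simp [hx i hi, hpz i hi]
  have axis0 : ∀ x : Fin 4 → ℝ, (∀ i, i ≠ 0 → x i = 0) → c i₀ x = x 0 / p 0 * c i₀ u :=
    fun x hx => by
      conv_lhs => rw [axis x hx]
      rw [map_smul, hp₀, smul_eq_mul]
  rcases (hy.1 l).eq_or_lt with hl | hl
  · left
    have hz : ∀ i, i ≠ 0 → y i = 0 := fun i hi => by
      rcases hall i with rfl | rfl | rfl | rfl
      · exact absurd rfl hi
      · exact hj
      · exact hk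
      · exact hl.symm
    have h1 := axis0 y hz
    rw [hy₀] at h1
    have h2 : y 0 / p 0 = 1 := by
      have := hcu.ne'
      field_simp at h1 ⊢
      linarith
    rw [axis y hz, h2, one_smul]
  · right
    refine ⟨fun z hz => ?_, l, hl, hpz l hl0⟩
    have hzc : c i₀ z = 0 := hz i₀ (by simp [hp₀, hy₀])
    have hzj : ∀ m, p m = y m → z m = 0 := fun m hm => by
      obtain ⟨i, hi⟩ := hbox m
      have := hz i (by simp [hi, hm])
      simpa [hi] using this
    refine ⟨- z l / y l, ?_⟩
    set w : Fin 4 → ℝ := z - (- z l / y l) • (p - y) with hw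
    have hwz : ∀ i, i ≠ 0 → w i = 0 := fun i hi => by
      rcases hall i with rfl | rfl | rfl | rfl
      · exact absurd rfl hi
      · simp [hw, hj, hpz _ hi, hzj i (by rw [hj, hpz _ hi])]
      · simp [hw, hk, hpz _ hi, hzj i (by rw [hk, hpz _ hi])]
      · simp only [hw, Pi.sub_apply, Pi.smul_apply, hpz _ hi, smul_eq_mul]
        field_simp
        ring
    have hwc : c i₀ w = 0 := by simp [hw, hzc, hp₀, hy₀]
    rw [axis0 w hwz] at hwc
    have hw0 : w 0 / p 0 = 0 := by
      rcases mul_eq_zero.mp hwc with h | h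
      · exact h
      · linarith
    have := axis w hwz
    rw [hw0, zero_smul] at this
    exact sub_eq_zero.mp this

lemma exists_axis_point [Finite ι] (hbox : ∀ k, ∃ i, c i = LinearMap.proj k)
    (hc : ∀ i, 0 < c i u) :
    ∃ i₀ p, Feas c u p ∧ c i₀ p = c i₀ u ∧ 0 < p 0 ∧ ∀ k, k ≠ 0 → p k = 0 := by
  let e : Fin 4 → ℝ := Pi.single 0 1
  obtain ⟨t, ht, hall, i₀, -, hi₀⟩ := exists_first_hit (fun i => c i u) (fun i => - c i e)
    (fun i => (hc i).le) (fun i _ => hc i)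
    (by obtain ⟨i, hi⟩ := hbox 0
        exact ⟨i, by simp [hi, e]⟩)
  refine ⟨i₀, t • e, ⟨fun k => ?_, fun i => ?_⟩, ?_, ?_, fun k hk => ?_⟩
  · rcases eq_or_ne k 0 with rfl | hk
    · simpa [e] using ht.le
    · simp [e, hk]
  · have := hall i
    simp only [map_smul, smul_eq_mul]
    linarith
  · simp only [map_smul, smul_eq_mul]
    linarith
  · simpa [e] using ht
  · simp [e, hk]

lemma exists_four_steps [Finite ι] (hbox : ∀ k, ∃ i, c i = LinearMap.proj k)
    (hu : ∀ k, 0 < u k) (hc : ∀ i, 0 < c i u) :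
    ∃ y₁ y₂ p, Feas c u y₁ ∧ Feas c u y₂ ∧ Feas c u p ∧
      Step c u y₁ ∧ Step c y₁ y₂ ∧ Step c y₂ p ∧ Step c p 0 := by
  obtain ⟨i₀, p, hp, hp₀, hppos, hpz⟩ := exists_axis_point hbox hc
  obtain ⟨y, hy, hmin⟩ := Set.exists_min_image (firstPoints c u i₀)
    (fun y => (y 1 + y 2 + y 3) / y 0) (finite_firstPoints hu i₀)
    (firstPoints_nonempty hbox hu i₀ hp hp₀ hppos hpz)
  have hlast : Step c p 0 := by
    refine Or.inr ⟨fun z hz => ⟨- z 0 / p 0, ?_⟩, 0, hppos, rfl⟩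
    ext k
    rcases eq_or_ne k 0 with rfl | hk
    · simp only [zero_sub, Pi.smul_apply, Pi.neg_apply, smul_eq_mul]
      field_simp
    · obtain ⟨i, hi⟩ := hbox k
      have := hz i (by simp [hi, hpz k hk])
      rw [hi, LinearMap.proj_apply] at this
      simp [this, hpz k hk]
  obtain ⟨hyF, hy₀, hypos, ⟨j, hj⟩, hray⟩ := id hy
  have hfirst : Step c u y :=
    Or.inr ⟨fun z hz => hray z fun i hi => hz i (by simp [hi]), j, hu j, hj⟩
  by_cases hk : ∃ k, k ≠ j ∧ y k = 0
  · obtain ⟨k, hkj, hk⟩ := hk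
    exact ⟨y, y, p, hyF, hyF, hp, hfirst, Or.inl rfl,
      step_to_axis hbox i₀ hp₀ hppos hpz (hc i₀) hyF hy₀ hypos hkj hj hk, hlast⟩
  · push Not at hk
    obtain ⟨y₂, hF, h₀, hpos, hj₂, ⟨k, hkj, hk₂⟩, hs⟩ :=
      exists_second_point hbox hu i₀ hp hp₀ hppos hpz hy hmin hj
        (fun k h => lt_of_le_of_ne (hyF.1 k) (hk k h).symm)
    exact ⟨y, y₂, p, hyF, hF, hp, hfirst, hs,
      step_to_axis hbox i₀ hp₀ hppos hpz (hc i₀) hF h₀ hpos hkj hj₂ hk₂, hlast⟩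

end Orthant

end SpindleWalk

namespace PolyData

variable {d f : ℕ}

/-- The `i`-th linear form of a polyhedron. -/
noncomputable def evalLin (P : PolyData d f) (i : Fin f) : (Fin d → ℝ) →ₗ[ℝ] ℝ where
  toFun := P.eval i
  map_add' x y := by simp [eval, mul_add, Finset.sum_add_distrib]
  map_smul' t x := by
    simp only [eval, Pi.smul_apply, smul_eq_mul, RingHom.id_apply, Finset.mul_sum]
    exact Finset.sum_congr rfl fun j _ => by ring

lemma evalLin_apply (P : PolyData d f) (i : Fin f) (x : Fin d → ℝ) :
    P.evalLin i x = P.eval i x := rfl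

lemma IsVertex.eq_zero_of_eval_eq_zero {P : PolyData d f} {v x : Fin d → ℝ} (hv : P.IsVertex v)
    (hx : ∀ i ∈ P.activeAt v, P.eval i x = 0) : x = 0 := by
  have h : ∀ z ∈ Submodule.span ℝ (P.row '' P.activeAt v), z ⬝ᵥ x = 0 := by
    intro z hz
    induction hz using Submodule.span_induction with
    | mem z hz =>
      obtain ⟨i, hi, rfl⟩ := hz
      exact hx i hi
    | zero => simp
    | add a b _ _ ha hb => rw [add_dotProduct, ha, hb, add_zero]
    | smul t a _ ha => rw [smul_dotProduct, ha, smul_zero]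
  exact dotProduct_self_eq_zero.mp (h x (by rw [hv.2]; trivial))

/-- A single maximal circuit move from `x` to `y`. -/
def CircuitMove (P : PolyData d f) (x y : Fin d → ℝ) : Prop :=
  ∃ g ∈ P.circuits, ∃ α : ℝ, 0 < α ∧ y = x + α • g ∧ ∀ β : ℝ, α < β → x + β • g ∉ P.toSet

/-- A circuit walk of length at most `n` from `x` to `z`. -/
def HasWalk (P : PolyData d f) (n : ℕ) (x z : Fin d → ℝ) : Prop :=
  ∃ (k : ℕ) (y : Fin (k+1) → Fin d → ℝ), k ≤ n ∧ P.IsCircuitWalk y ∧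
    y 0 = x ∧ y (Fin.last k) = z

lemma hasWalk_refl {P : PolyData d f} {x : Fin d → ℝ} (hx : x ∈ P.toSet) : P.HasWalk 0 x x :=
  ⟨0, fun _ => x, le_rfl, ⟨fun _ => hx, fun i => i.elim0⟩, rfl, rfl⟩

lemma HasWalk.cons {P : PolyData d f} {n : ℕ} {x y z : Fin d → ℝ} (h : P.HasWalk n y z)
    (hx : x ∈ P.toSet) (hxy : x = y ∨ P.CircuitMove x y) : P.HasWalk (n + 1) x z := by
  obtain ⟨k, w, hk, ⟨hw, hs⟩, rfl, rfl⟩ := h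
  rcases hxy with rfl | hmove
  · exact ⟨k, w, by omega, ⟨hw, hs⟩, rfl, rfl⟩
  · refine ⟨k + 1, Fin.cons x w, by omega, ⟨fun i => ?_, fun i => ?_⟩, rfl, ?_⟩
    · refine Fin.cases ?_ (fun j => ?_) i
      · simpa using hx
      · simpa using hw j
    · refine Fin.cases ?_ (fun j => ?_) i
      · simpa [CircuitMove] using hmove
      · have := hs j
        rw [← Fin.succ_castSucc]
        simpa only [Fin.cons_succ] using this
    · rw [← Fin.succ_last, Fin.cons_succ]

end PolyData

/-- Lemma 19: in an unbounded `4`-dimensional spindle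
`P(u,v)` whose cone at `v` is simple (exactly `4` facets incident to `v`),
there is a circuit walk of length at most `4` from `u` to `v`. -/
theorem unbounded_spindle_circuit_walk (f : ℕ) (P : PolyData 4 f)
    (hP : P.IsProper) (hub : ¬ Bornology.IsBounded P.toSet)
    (u v : Fin 4 → ℝ) (hu : P.IsVertex u) (hv : P.IsVertex v)
    (hdisj : Disjoint (P.activeAt u) (P.activeAt v))
    (hcover : P.activeAt u ∪ P.activeAt v = Set.univ)
    (hvsimple : (P.activeAt v).ncard = 4) :
    ∃ (k : ℕ) (y : Fin (k+1) → Fin 4 → ℝ), k ≤ 4 ∧ P.IsCircuitWalk y ∧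
      y 0 = u ∧ y (Fin.last k) = v := by
  classical
  have hslack : ∀ {w : Fin 4 → ℝ}, w ∈ P.toSet → ∀ i ∉ P.activeAt w, P.rhs i < P.eval i w :=
    fun hw i hi => lt_of_le_of_ne (hw i) (Ne.symm hi)
  let σ : Fin 4 ≃ P.activeAt v := (Finite.equivFinOfCardEq hvsimple).symm
  let T₀ : (Fin 4 → ℝ) →ₗ[ℝ] (Fin 4 → ℝ) := LinearMap.pi fun k => P.evalLin (σ k)
  have hT₀ : Function.Injective T₀ := by
    rw [← LinearMap.ker_eq_bot, LinearMap.ker_eq_bot']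
    refine fun x hx => hv.eq_zero_of_eval_eq_zero fun i hi => ?_
    have := congrFun hx (σ.symm ⟨i, hi⟩)
    simpa [T₀, P.evalLin_apply] using this
  let T : (Fin 4 → ℝ) ≃ₗ[ℝ] (Fin 4 → ℝ) := LinearEquiv.ofInjectiveEndo T₀ hT₀
  have hT : ∀ x k, T x k = P.evalLin (σ k) x := fun x k => rfl
  have hTs : ∀ x k, P.evalLin (σ k) (T.symm x) = x k := fun x k => by
    rw [← hT, T.apply_symm_apply]
  let c : Fin f → (Fin 4 → ℝ) →ₗ[ℝ] ℝ := fun i =>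
    if i ∈ P.activeAt v then P.evalLin i ∘ₗ T.symm.toLinearMap
    else -(P.evalLin i ∘ₗ T.symm.toLinearMap)
  have hcv : ∀ i ∈ P.activeAt v, ∀ x, c i x = P.evalLin i (T.symm x) := fun i hi x => by
    simp [c, hi]
  have hcu : ∀ i ∉ P.activeAt v, ∀ x, c i x = -P.evalLin i (T.symm x) := fun i hi x => by
    simp [c, hi]
  have hc0 : ∀ i x, c i x = 0 ↔ P.evalLin i (T.symm x) = 0 := fun i x => by
    by_cases hi : i ∈ P.activeAt v
    · rw [hcv i hi]
    · rw [hcu i hi, neg_eq_zero]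
  have hact : ∀ i ∉ P.activeAt v, i ∈ P.activeAt u := fun i hi => by
    have : i ∈ P.activeAt u ∪ P.activeAt v := hcover ▸ Set.mem_univ i
    exact this.resolve_right hi
  have hbox : ∀ k, ∃ i, c i = LinearMap.proj k := fun k =>
    ⟨σ k, LinearMap.ext fun x => by rw [hcv _ (σ k).2, hTs]; rfl⟩
  have hpos : ∀ i ∈ P.activeAt v, 0 < P.evalLin i (u - v) := fun i hi => by
    have h1 := hslack hu.1 i fun h => Set.disjoint_left.mp hdisj h hi
    have h2 : P.eval i v = P.rhs i := hi
    rw [map_sub, P.evalLin_apply, P.evalLin_apply]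
    linarith
  have hu' : ∀ k, 0 < T (u - v) k := fun k => by
    rw [hT]
    exact hpos _ (σ k).2
  have hc : ∀ i, 0 < c i (T (u - v)) := fun i => by
    by_cases hi : i ∈ P.activeAt v
    · rw [hcv i hi, T.symm_apply_apply]
      exact hpos i hi
    · have h1 := hslack hv.1 i hi
      have h2 : P.eval i u = P.rhs i := hact i hi
      rw [hcu i hi, T.symm_apply_apply, map_sub, P.evalLin_apply, P.evalLin_apply]
      linarith
  have hfeas : ∀ x, SpindleWalk.Feas c (T (u - v)) x → v + T.symm x ∈ P.toSet := by
    rintro x ⟨hx, hx'⟩ i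
    rw [← P.evalLin_apply, map_add]
    by_cases hi : i ∈ P.activeAt v
    · have h1 : P.evalLin i v = P.rhs i := hi
      have h2 := hTs x (σ.symm ⟨i, hi⟩)
      rw [σ.apply_symm_apply] at h2
      linarith [hx (σ.symm ⟨i, hi⟩)]
    · have h1 : P.evalLin i u = P.rhs i := hact i hi
      have h2 := hx' i
      rw [hcu i hi, hcu i hi, T.symm_apply_apply, map_sub] at h2
      linarith
  have hstep : ∀ x y, SpindleWalk.Step c x y →
      v + T.symm x = v + T.symm y ∨ P.CircuitMove (v + T.symm x) (v + T.symm y) := by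
    rintro x y (rfl | ⟨hray, k, hxk, hyk⟩)
    · exact Or.inl rfl
    · refine Or.inr ⟨T.symm (y - x), ⟨fun h0 => ?_, fun z hz hsub => ?_⟩, 1, one_pos, ?_,
        fun β hβ hmem => ?_⟩
      · have := congrFun (T.symm.map_eq_zero_iff.mp h0) k
        simp only [Pi.sub_apply, Pi.zero_apply] at this
        linarith
      · obtain ⟨t, ht⟩ := hray (T z) fun i hi => by
          rw [hc0] at hi ⊢
          rw [T.symm_apply_apply]
          by_contra hne
          exact hsub hne hi
        have hzt : z = t • T.symm (y - x) := by
          rw [← map_smul, ← ht, T.symm_apply_apply]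
        have ht0 : t ≠ 0 := by
          rintro rfl
          exact hz (by rw [hzt, zero_smul])
        ext i
        simp only [Set.mem_ofPred_eq, ← P.evalLin_apply]
        rw [hzt, map_smul, smul_eq_mul]
        simp [ht0]
      · rw [one_smul, map_sub]
        abel
      · have h1 := hmem (σ k)
        have h2 : P.evalLin (σ k) v = P.rhs (σ k) := (σ k).2
        rw [← P.evalLin_apply, map_add, map_add, map_smul, hTs, hTs, h2, smul_eq_mul,
          Pi.sub_apply, hyk] at h1
        nlinarith
  obtain ⟨y₁, y₂, p, h1, h2, h3, s1, s2, s3, s4⟩ := SpindleWalk.exists_four_steps hbox hu' hc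
  have hY0 : v + T.symm 0 = v := by simp
  have hYu : v + T.symm (T (u - v)) = u := by simp
  have e1 := hstep _ _ s1
  have e4 := hstep _ _ s4
  rw [hYu] at e1
  rw [hY0] at e4
  exact ((((PolyData.hasWalk_refl hv.1).cons (hfeas _ h3) e4).cons (hfeas _ h2) (hstep _ _ s3)).cons
    (hfeas _ h1) (hstep _ _ s2)).cons hu.1 e1
end
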